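/- Let n ≥ 1 and d ≥ 1 be integers and let A = (A₀,…,A_d) be a tuple of real n×n matrices whose (d+1)n² entries are i.i.d. standard normal N(0,1) random variables. Then E[μ(A)] ≤ √π · n · Γ((d+1)n²/2)/Γ(((d+1)n²−1)/2). -/

import Mathlib

open MeasureTheory ProbabilityTheory Real
open scoped ENNReal Matrix Classical

namespace PEVP

/-- Tuples of `d+1` real `n × n` matrices, as bare functions (for the product measure). -/
abbrev MatTuple (n d : ℕ) := Fin (d + 1) → Fin n → Fin n → ℝ

/-- The Gaussian measure on tuples: all `(d+1)·n²` entries are i.i.d. `N(0,1)`. -/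
noncomputable def gaussTuple (n d : ℕ) : Measure (MatTuple n d) :=
  Measure.pi fun _ => Measure.pi fun _ => Measure.pi fun _ => gaussianReal 0 1

/-- The matrix `P(A,α,β) = ∑ αⁱ β^{d-i} Aᵢ`. -/
noncomputable def Pmat (n d : ℕ) (A : MatTuple n d) (α β : ℝ) : Matrix (Fin n) (Fin n) ℝ :=
  ∑ i : Fin (d + 1), (α ^ (i : ℕ) * β ^ (d - (i : ℕ))) • Matrix.of (A i)

/-- `(α,β)` is a polynomial eigenvalue of `A`. -/
def IsPEV (n d : ℕ) (A : MatTuple n d) (α β : ℝ) : Prop := (Pmat n d A α β).det = 0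

/-- `∂P/∂α (A,α,β)`. -/
noncomputable def Pα (n d : ℕ) (A : MatTuple n d) (α β : ℝ) : Matrix (Fin n) (Fin n) ℝ :=
  ∑ i : Fin (d + 1), (((i : ℕ) : ℝ) * α ^ ((i : ℕ) - 1) * β ^ (d - (i : ℕ))) • Matrix.of (A i)

/-- `∂P/∂β (A,α,β)`. -/
noncomputable def Pβ (n d : ℕ) (A : MatTuple n d) (α β : ℝ) : Matrix (Fin n) (Fin n) ℝ :=
  ∑ i : Fin (d + 1),
    (((d : ℝ) - ((i : ℕ) : ℝ)) * α ^ (i : ℕ) * β ^ (d - (i : ℕ) - 1)) • Matrix.of (A i)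

/-- The vector `v = β·(∂P/∂α)·r − α·(∂P/∂β)·r`. -/
noncomputable def vvec (n d : ℕ) (A : MatTuple n d) (α β : ℝ) (r : Fin n → ℝ) : Fin n → ℝ :=
  β • (Pα n d A α β).mulVec r - α • (Pβ n d A α β).mulVec r

/-- `r` spans the (one-dimensional) kernel of `P(A,α,β)`, `ℓ` spans the kernel of its
transpose, and `ℓᵗ v ≠ 0`. -/
def GoodPair (n d : ℕ) (A : MatTuple n d) (α β : ℝ) (r ℓ : Fin n → ℝ) : Prop :=
  r ≠ 0 ∧ ℓ ≠ 0 ∧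
    LinearMap.ker (Matrix.toLin' (Pmat n d A α β)) = Submodule.span ℝ {r} ∧
    LinearMap.ker (Matrix.toLin' (Pmat n d A α β)ᵀ) = Submodule.span ℝ {ℓ} ∧
    ∑ j, ℓ j * vvec n d A α β r j ≠ 0

/-- Euclidean norm of a vector in `ℝⁿ`. -/
noncomputable def vnorm (n : ℕ) (r : Fin n → ℝ) : ℝ := Real.sqrt (∑ j, r j ^ 2)

/-- The norm `‖A‖ = (∑ᵢ ‖Aᵢ‖_F²)^{1/2}` of a tuple of matrices. -/
noncomputable def tnorm (n d : ℕ) (A : MatTuple n d) : ℝ :=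
  Real.sqrt (∑ i, ∑ j, ∑ k, A i j k ^ 2)

/-- The value `(∑ α^{2k} β^{2(d-k)})^{1/2} · (‖r‖‖ℓ‖ / |ℓᵗv|) · ‖A‖`. -/
noncomputable def muVal (n d : ℕ) (A : MatTuple n d) (α β : ℝ) (r ℓ : Fin n → ℝ) : ℝ :=
  Real.sqrt (∑ k ∈ Finset.range (d + 1), α ^ (2 * k) * β ^ (2 * (d - k))) *
    (vnorm n r * vnorm n ℓ / |∑ j, ℓ j * vvec n d A α β r j|) * tnorm n d A

/-- The local condition number `μ(A,(α,β)) ∈ [0,∞]`. -/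
noncomputable def muLoc (n d : ℕ) (A : MatTuple n d) (α β : ℝ) : ℝ≥0∞ :=
  if h : ∃ p : (Fin n → ℝ) × (Fin n → ℝ), GoodPair n d A α β p.1 p.2 then
    ENNReal.ofReal (muVal n d A α β h.choose.1 h.choose.2)
  else ⊤

/-- A set of canonical representatives for `ℝP¹`: one unit vector in each pair `±(α,β)`. -/
def circleReps : Set (ℝ × ℝ) :=
  {x | x.1 ^ 2 + x.2 ^ 2 = 1 ∧ (0 < x.2 ∨ (x.2 = 0 ∧ x.1 = 1))}

/-- The polynomial eigenvalues of `A`, as (canonical representatives of) points of `ℝP¹`. -/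
def pevReps (n d : ℕ) (A : MatTuple n d) : Set (ℝ × ℝ) :=
  {x ∈ circleReps | IsPEV n d A x.1 x.2}

/-- The condition number `μ(A) ∈ [0,∞]`: the sum of the local condition numbers over all
polynomial eigenvalues `[α:β] ∈ ℝP¹`, set to `∞` when there are infinitely many of them. -/
noncomputable def muTotal (n d : ℕ) (A : MatTuple n d) : ℝ≥0∞ :=
  if (pevReps n d A).Infinite then ⊤
  else ∑' x : pevReps n d A, muLoc n d A x.1.1 x.1.2

lemma map_pi_eq_gaussianReal {ι : Type*} [Fintype ι] [DecidableEq ι] {E : ι → Type*}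
    [∀ i, NormedAddCommGroup (E i)] [∀ i, NormedSpace ℝ (E i)] [∀ i, MeasurableSpace (E i)]
    [∀ i, BorelSpace (E i)] [∀ i, SecondCountableTopology (E i)]
    {μ : ∀ i, Measure (E i)} [∀ i, IsProbabilityMeasure (μ i)]
    {v : ∀ i, StrongDual ℝ (E i) → NNReal}
    (h : ∀ (i) (L : StrongDual ℝ (E i)), (μ i).map L = gaussianReal 0 (v i L)) (L : StrongDual ℝ (∀ i, E i)) :
    (Measure.pi μ).map L =
      gaussianReal 0 (∑ i, v i (L.comp (ContinuousLinearMap.single ℝ E i))) := by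
  have : IsProbabilityMeasure ((Measure.pi μ).map L) :=
    Measure.isProbabilityMeasure_map L.continuous.measurable.aemeasurable
  refine Measure.ext_of_charFun ?_
  ext t
  rw [charFun_map_eq_charFunDual_smul, charFunDual_pi]
  have : ∀ i, charFunDual (μ i) ((t • L).comp (ContinuousLinearMap.single ℝ E i)) =
      Complex.exp (-(v i (L.comp (ContinuousLinearMap.single ℝ E i)) * t ^ 2 / 2 : ℂ)) := by
    intro i
    rw [ContinuousLinearMap.smul_comp, ← charFun_map_eq_charFunDual_smul, h i,
      charFun_gaussianReal]
    simp
  simp_rw [this, charFun_gaussianReal, ← Complex.exp_sum]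
  simp [Finset.sum_mul, Finset.sum_div]

/-- The variance of a linear functional under `gaussTuple`. -/
noncomputable def dualVar (n d : ℕ) (L : StrongDual ℝ (MatTuple n d)) : NNReal :=
  ∑ i, ∑ j, ∑ k, ‖L (Pi.single i (Pi.single j (Pi.single k 1)))‖₊ ^ 2

lemma gaussTuple_map_dual (n d : ℕ) (L : StrongDual ℝ (MatTuple n d)) :
    (gaussTuple n d).map L = gaussianReal 0 (dualVar n d L) := by
  have h1 : ∀ L : StrongDual ℝ ℝ, (gaussianReal 0 1).map L = gaussianReal 0 (‖L 1‖₊ ^ 2) := by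
    intro L
    have : (L : ℝ → ℝ) = fun x => L 1 * x := by
      ext x
      rw [mul_comm, ← smul_eq_mul, ← map_smul, smul_eq_mul, mul_one]
    rw [this, gaussianReal_map_const_mul]
    congr 1
    · simp
    · ext; simp
  have h2 := map_pi_eq_gaussianReal (ι := Fin n) (μ := fun _ => gaussianReal 0 1) fun _ => h1
  have h3 := map_pi_eq_gaussianReal (ι := Fin n)
    (μ := fun _ => Measure.pi fun _ : Fin n => gaussianReal 0 1) fun _ => h2
  have h4 := map_pi_eq_gaussianReal (ι := Fin (d + 1))
    (μ := fun _ => Measure.pi fun _ : Fin n => Measure.pi fun _ : Fin n => gaussianReal 0 1)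
    (fun _ => h3) L
  rw [gaussTuple, h4]
  simp [dualVar]

instance (n d : ℕ) : IsProbabilityMeasure (gaussTuple n d) := by
  unfold gaussTuple; infer_instance

instance (n d : ℕ) : IsGaussian (gaussTuple n d) :=
  isGaussian_of_map_eq_gaussianReal fun L => ⟨0, _, gaussTuple_map_dual n d L⟩

lemma gaussTuple_prod_map_rotation (n d : ℕ) (t : ℝ) :
    ((gaussTuple n d).prod (gaussTuple n d)).map (ContinuousLinearMap.rotation t) =
      (gaussTuple n d).prod (gaussTuple n d) := by
  refine IsGaussian.map_rotation_eq_self_of_forall_strongDual_eq_zero (fun L => ?_) t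
  have := integral_map (μ := gaussTuple n d) (φ := L) (f := id)
    L.continuous.measurable.aemeasurable aestronglyMeasurable_id
  rw [gaussTuple_map_dual] at this
  simpa using this.symm

lemma lintegral_abs_gaussianReal (v : NNReal) :
    ∫⁻ x, ENNReal.ofReal |x| ∂gaussianReal 0 v = ENNReal.ofReal (√(2 / π) * √v) := by
  have h1 : ∫⁻ x, ENNReal.ofReal |x| ∂gaussianReal 0 1 = ENNReal.ofReal √(2 / π) := by
    rw [← ofReal_integral_eq_lintegral_ofReal]
    · congr 1
      rw [integral_gaussianReal_eq_integral_smul one_ne_zero]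
      have : ∀ x : ℝ, gaussianPDFReal 0 1 x • |x| =
          (fun y : ℝ => (√(2 * π))⁻¹ * (y ^ (1 : ℝ) * rexp (-(1 / 2) * y ^ (2 : ℝ)))) |x| := by
        intro x
        simp only [gaussianPDFReal, smul_eq_mul, NNReal.coe_one, mul_one, sub_zero, rpow_one,
          rpow_two, sq_abs]
        rw [mul_assoc, mul_comm (rexp _)]
        congr 3
        ring
      rw [integral_congr_ae (ae_of_all _ this), integral_comp_abs (f := fun y : ℝ =>
        (√(2 * π))⁻¹ * (y ^ (1 : ℝ) * rexp (-(1 / 2) * y ^ (2 : ℝ)))), integral_const_mul,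
        integral_rpow_mul_exp_neg_mul_rpow (by norm_num) (by norm_num) (by norm_num)]
      norm_num
      have h : √2 * √2 = (2 : ℝ) := Real.mul_self_sqrt (by norm_num)
      field_simp
      nlinarith
    · exact ((memLp_id_gaussianReal 1).integrable le_rfl).abs
    · exact ae_of_all _ fun x => abs_nonneg x
  have h2 : gaussianReal 0 v = (gaussianReal 0 1).map (fun x => √v * x) := by
    rw [gaussianReal_map_const_mul]
    congr 1
    · simp
    · ext; simp
  rw [h2, lintegral_map (by fun_prop) (by fun_prop)]
  simp_rw [abs_mul, abs_of_nonneg (Real.sqrt_nonneg _), ENNReal.ofReal_mul (Real.sqrt_nonneg (v : ℝ))]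
  rw [lintegral_const_mul _ (by fun_prop), h1, mul_comm, ENNReal.ofReal_mul (by positivity)]

lemma lintegral_abs_dual_gaussTuple (n d : ℕ) (L : StrongDual ℝ (MatTuple n d)) :
    ∫⁻ B, ENNReal.ofReal |L B| ∂gaussTuple n d =
      ENNReal.ofReal (√(2 / π) *
        √(∑ i, ∑ j, ∑ k, (L (Pi.single i (Pi.single j (Pi.single k 1)))) ^ 2)) := by
  rw [← lintegral_map (f := fun x : ℝ => ENNReal.ofReal |x|) (by fun_prop)
    L.continuous.measurable, gaussTuple_map_dual, lintegral_abs_gaussianReal]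
  simp [dualVar]

lemma exists_Ioo_injOn_of_deriv_ne_zero {q q' : ℝ → ℝ} (hq : ∀ t, HasDerivAt q (q' t) t)
    (hq' : Continuous q') {t : ℝ} (ht : q' t ≠ 0) :
    ∃ a b : ℚ, t ∈ Set.Ioo (a : ℝ) b ∧ Set.InjOn q (Set.Ioo (a : ℝ) b) := by
  have hn : {s | q' s ≠ 0} ∈ nhds t := hq'.continuousAt.eventually_ne ht
  obtain ⟨ε, hε, hb⟩ := Metric.mem_nhds_iff.mp hn
  obtain ⟨a, ha1, ha2⟩ := exists_rat_btwn (show t - ε < t by linarith)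
  obtain ⟨b, hb1, hb2⟩ := exists_rat_btwn (show t < t + ε by linarith)
  refine ⟨a, b, ⟨ha2, hb1⟩, ?_⟩
  intro x hx y hy hxy
  by_contra hne
  wlog hlt : x < y generalizing x y
  · exact this hy hx hxy.symm (Ne.symm hne) (lt_of_le_of_ne (not_lt.mp hlt) (Ne.symm hne))
  obtain ⟨c, hc, hc'⟩ := exists_hasDerivAt_eq_zero hlt
    (fun s _ => (hq s).continuousAt.continuousWithinAt) hxy fun s _ => hq s
  refine hb ?_ hc'
  rw [Real.ball_eq_Ioo]
  exact ⟨by linarith [hx.1, hc.1], by linarith [hy.2, hc.2]⟩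

/-- Area formula inequality: if each level of `q` contains at most `M` regular points of `S`,
the integral of `|q'|` over `S ∩ q⁻¹ B` is at most `M` times the measure of `B`. -/
lemma lintegral_abs_deriv_le_of_card_le {q q' : ℝ → ℝ} (hq : ∀ t, HasDerivAt q (q' t) t)
    (hq' : Continuous q') {S : Set ℝ} (hS : MeasurableSet S) {M : ℕ}
    (hM : ∀ (y : ℝ) (T : Finset ℝ), (∀ t ∈ T, t ∈ S ∧ q t = y ∧ q' t ≠ 0) → T.card ≤ M)
    {B : Set ℝ} (hB : MeasurableSet B) :
    ∫⁻ t in S ∩ q ⁻¹' B, ENNReal.ofReal |q' t| ≤ M * volume B := by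
  have hqc : Continuous q := continuous_iff_continuousAt.mpr fun t => (hq t).continuousAt
  obtain ⟨e, he⟩ := exists_surjective_nat (ℚ × ℚ)
  set U : ℕ → Set ℝ := fun i =>
    if Set.InjOn q (Set.Ioo ((e i).1 : ℝ) (e i).2) then Set.Ioo ((e i).1 : ℝ) (e i).2 else ∅ with hU
  have hUm : ∀ i, MeasurableSet (U i) := by
    intro i; simp only [hU]; split_ifs
    · exact measurableSet_Ioo
    · exact MeasurableSet.empty
  have hUi : ∀ i, Set.InjOn q (U i) := by
    intro i; simp only [hU]; split_ifs with h
    · exact h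
    · exact Set.injOn_empty _
  have hUc : ∀ t, q' t ≠ 0 → t ∈ ⋃ i, U i := by
    intro t ht
    obtain ⟨a, b, hab, hinj⟩ := exists_Ioo_injOn_of_deriv_ne_zero hq hq' ht
    obtain ⟨i, hi⟩ := he (a, b)
    refine Set.mem_iUnion.mpr ⟨i, ?_⟩
    simp only [hU, hi]
    rw [if_pos hinj]; exact hab
  have hNm : MeasurableSet {t | q' t ≠ 0} := (isOpen_ne_fun hq' continuous_const).measurableSet
  set W : Set ℝ := (S ∩ q ⁻¹' B) ∩ {t | q' t ≠ 0} with hW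
  have hWm : MeasurableSet W := (hS.inter (hqc.measurable hB)).inter hNm
  set V : ℕ → Set ℝ := fun i => disjointed U i ∩ W with hV
  have hVm : ∀ i, MeasurableSet (V i) := fun i => (MeasurableSet.disjointed hUm i).inter hWm
  have hVi : ∀ i, Set.InjOn q (V i) := fun i =>
    (hUi i).mono (Set.inter_subset_left.trans (disjointed_subset U i))
  have hVd : Pairwise (Function.onFun Disjoint V) := fun i j hij =>
    (disjoint_disjointed U hij).mono Set.inter_subset_left Set.inter_subset_left
  have hVU : ⋃ i, V i = W := by
    rw [← Set.iUnion_inter, iUnion_disjointed, Set.inter_eq_right]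
    exact fun t ht => hUc t ht.2
  have hVim : ∀ i, MeasurableSet (q '' V i) := fun i =>
    (hVm i).image_of_continuousOn_injOn hqc.continuousOn (hVi i)
  have hVint : ∀ i, ∫⁻ t in V i, ENNReal.ofReal |q' t| =
      ∫⁻ y in B, (q '' V i).indicator 1 y := by
    intro i
    have h := lintegral_image_eq_lintegral_abs_deriv_mul (hVm i)
      (fun x _ => (hq x).hasDerivWithinAt) (hVi i) (fun _ => 1)
    simp only [mul_one] at h
    rw [← h, lintegral_indicator (hVim i), Measure.restrict_restrict (hVim i),
      Set.inter_eq_left.mpr]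
    · rfl
    · rintro _ ⟨t, ht, rfl⟩
      exact ht.2.1.2
  have hcount : ∀ y, ∑' i, (q '' V i).indicator (1 : ℝ → ℝ≥0∞) y ≤ M := by
    intro y
    refine ENNReal.tsum_le_of_sum_range_le fun k => ?_
    simp only [Set.indicator_apply, Pi.one_apply]
    rw [Finset.sum_boole]
    have hch : ∀ i : ℕ, ∃ t, y ∈ q '' V i → t ∈ V i ∧ q t = y := by
      intro i
      by_cases h : y ∈ q '' V i
      · obtain ⟨t, ht⟩ := h
        exact ⟨t, fun _ => ht⟩
      · exact ⟨0, fun h' => absurd h' h⟩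
    choose τ hτ using hch
    set I := (Finset.range k).filter fun i => y ∈ q '' V i with hI
    have hinj : Set.InjOn τ I := by
      intro i hi j hj hij
      by_contra hne
      have h1 := (hτ i (Finset.mem_filter.mp hi).2).1
      have h2 := (hτ j (Finset.mem_filter.mp hj).2).1
      rw [hij] at h1
      exact Set.disjoint_left.mp (hVd hne) h1 h2
    have := hM y (I.image τ) (by
      intro t ht
      obtain ⟨i, hi, rfl⟩ := Finset.mem_image.mp ht
      have h1 := hτ i (Finset.mem_filter.mp hi).2
      exact ⟨h1.1.2.1.1, h1.2, h1.1.2.2⟩)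
    rw [Finset.card_image_of_injOn hinj] at this
    exact_mod_cast this
  calc ∫⁻ t in S ∩ q ⁻¹' B, ENNReal.ofReal |q' t|
      = ∫⁻ t in W, ENNReal.ofReal |q' t| := by
        rw [hW, ← lintegral_indicator (hS.inter (hqc.measurable hB)),
          ← lintegral_indicator hWm]
        refine lintegral_congr fun t => ?_
        by_cases h : q' t = 0
        · simp [Set.indicator_apply, h]
        · simp [Set.indicator_apply, hW, h]
    _ = ∑' i, ∫⁻ t in V i, ENNReal.ofReal |q' t| := by
        rw [← hVU, lintegral_iUnion hVm hVd]
    _ = ∫⁻ y in B, ∑' i, (q '' V i).indicator 1 y := by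
        simp_rw [hVint]
        rw [lintegral_tsum]
        exact fun i => (measurable_one.indicator (hVim i)).aemeasurable
    _ ≤ ∫⁻ _ in B, (M : ℝ≥0∞) := lintegral_mono hcount
    _ = M * volume B := by simp

/-- Jacobi's formula. -/
lemma hasDerivAt_det {ι : Type*} [Fintype ι] [DecidableEq ι] {X : ℝ → Matrix ι ι ℝ}
    {X' : Matrix ι ι ℝ} {t : ℝ} (h : ∀ i j, HasDerivAt (fun s => X s i j) (X' i j) t) :
    HasDerivAt (fun s => (X s).det) (((X t).adjugate * X').trace) t := by
  simp_rw [Matrix.det_apply']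
  have h1 : ∀ σ : Equiv.Perm ι, HasDerivAt
      (fun s => ((Equiv.Perm.sign σ : ℤ) : ℝ) * ∏ i, X s (σ i) i)
      (((Equiv.Perm.sign σ : ℤ) : ℝ) *
        ∑ i, (∏ j ∈ Finset.univ.erase i, X t (σ j) j) • X' (σ i) i) t := fun σ =>
    (HasDerivAt.fun_finsetProd fun i _ => h (σ i) i).const_mul _
  have h2 := HasDerivAt.fun_sum (u := Finset.univ) fun σ (_ : σ ∈ Finset.univ) => h1 σ
  refine h2.congr_deriv (Eq.symm ?_)
  have h3 : ∀ i, ((X t).adjugate * X') i i =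
      ∑ σ : Equiv.Perm ι, ((Equiv.Perm.sign σ : ℤ) : ℝ) *
        ((∏ j ∈ Finset.univ.erase i, X t (σ j) j) • X' (σ i) i) := by
    intro i
    have : ((X t).adjugate * X') i i = ((X t).updateCol i (X'.col i)).det := by
      rw [← Matrix.cramer_apply, Matrix.cramer_eq_adjugate_mulVec]
      rfl
    rw [this, Matrix.det_apply']
    refine Finset.sum_congr rfl fun σ _ => ?_
    congr 1
    rw [← Finset.prod_erase_mul _ _ (Finset.mem_univ i), smul_eq_mul]
    congr 1
    · refine Finset.prod_congr rfl fun j hj => ?_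
      rw [Matrix.updateCol_ne (Finset.ne_of_mem_erase hj)]
    · rw [Matrix.updateCol_self]
      rfl
  simp_rw [Finset.mul_sum]
  rw [Finset.sum_comm]
  exact Finset.sum_congr rfl fun i _ => h3 i

/-- A level of `t ↦ det (cos t • X + sin t • Y)` has at most `2n` regular points on a period. -/
lemma card_level_det_rotation_le {n : ℕ} (X Y : Matrix (Fin n) (Fin n) ℝ) {q' : ℝ → ℝ}
    (hq : ∀ t, HasDerivAt (fun t => (Real.cos t • X + Real.sin t • Y).det) (q' t) t)
    (y : ℝ) (T : Finset ℝ)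
    (hT : ∀ t ∈ T, t ∈ Set.Ioc (-π) π ∧ (Real.cos t • X + Real.sin t • Y).det = y ∧ q' t ≠ 0) :
    T.card ≤ 2 * n := by
  set A : Matrix (Fin n) (Fin n) ℂ := X.map Complex.ofReal - Complex.I • Y.map Complex.ofReal
  set B : Matrix (Fin n) (Fin n) ℂ := X.map Complex.ofReal + Complex.I • Y.map Complex.ofReal
  set p : Polynomial ℂ :=
    (((Polynomial.X : Polynomial ℂ) • A.map Polynomial.C + B.map Polynomial.C).det).comp
    (Polynomial.X ^ 2) - Polynomial.C (2 ^ n * (y : ℂ)) * Polynomial.X ^ n with hp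
  have hdeg : p.natDegree ≤ 2 * n := by
    refine (Polynomial.natDegree_sub_le _ _).trans (max_le ?_ ?_)
    · rw [Polynomial.natDegree_comp, Polynomial.natDegree_X_pow, mul_comm]
      have := Polynomial.natDegree_det_X_add_C_le A B
      rw [Fintype.card_fin] at this
      exact Nat.mul_le_mul_left _ this
    · exact (Polynomial.natDegree_C_mul_X_pow_le _ _).trans (by omega)
  have heval : ∀ t : ℝ, p.eval (Complex.exp (t * Complex.I)) =
      2 ^ n * Complex.exp (t * Complex.I) ^ n *
        (((Real.cos t • X + Real.sin t • Y).det - y : ℝ) : ℂ) := by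
    intro t
    set z := Complex.exp (t * Complex.I) with hz
    have hz' : z = Complex.cos t + Complex.sin t * Complex.I := Complex.exp_mul_I t
    have hdet : (((Polynomial.X : Polynomial ℂ) • A.map Polynomial.C + B.map Polynomial.C).det).eval (z ^ 2) =
        (z ^ 2 • A + B).det := by
      rw [← Polynomial.coe_evalRingHom, RingHom.map_det]
      congr 1
      ext i j
      simp only [RingHom.mapMatrix_apply, Matrix.map_apply, Matrix.add_apply, Matrix.smul_apply, smul_eq_mul,
        Polynomial.coe_evalRingHom, Polynomial.eval_add, Polynomial.eval_mul, Polynomial.eval_X, Polynomial.eval_C]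
    have hmat : z ^ 2 • A + B =
        (2 * z) • (Real.cos t • X + Real.sin t • Y).map Complex.ofReal := by
      ext i j
      have hcs := Complex.sin_sq_add_cos_sq (t : ℂ)
      have hI := Complex.I_mul_I
      simp only [A, B, Matrix.add_apply, Matrix.smul_apply, Matrix.sub_apply, Matrix.map_apply,
        smul_eq_mul, Complex.ofReal_add, Complex.ofReal_mul, Complex.ofReal_cos,
        Complex.ofReal_sin]
      rw [hz']
      set c := Complex.cos (t : ℂ)
      set s := Complex.sin (t : ℂ)
      set x : ℂ := (X i j : ℂ)
      set w : ℂ := (Y i j : ℂ)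
      linear_combination (-x - w * Complex.I) * hcs +
        (s ^ 2 * x - s ^ 2 * w * Complex.I - 2 * c * s * w ) * hI
    have h3 : ((Real.cos t • X + Real.sin t • Y).map Complex.ofReal).det =
        (((Real.cos t • X + Real.sin t • Y).det : ℝ) : ℂ) :=
      (RingHom.map_det Complex.ofRealHom _).symm
    rw [hp, Polynomial.eval_sub, Polynomial.eval_comp, Polynomial.eval_pow, Polynomial.eval_X,
      hdet, hmat, Matrix.det_smul, h3, Fintype.card_fin]
    simp only [Polynomial.eval_mul, Polynomial.eval_C, Polynomial.eval_pow, Polynomial.eval_X,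
      Complex.ofReal_sub]
    ring
  by_cases hp0 : p = 0
  · have hconst : ∀ t : ℝ, (Real.cos t • X + Real.sin t • Y).det = y := by
      intro t
      have h := heval t
      rw [hp0, Polynomial.eval_zero, eq_comm] at h
      have hne : (2 : ℂ) ^ n * Complex.exp (t * Complex.I) ^ n ≠ 0 :=
        mul_ne_zero (pow_ne_zero _ two_ne_zero) (pow_ne_zero _ (Complex.exp_ne_zero _))
      have h' := (mul_eq_zero.mp h).resolve_left hne
      have h'' : (Real.cos t • X + Real.sin t • Y).det - y = 0 := by exact_mod_cast h'
      linarith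
    rcases T.eq_empty_or_nonempty with rfl | ⟨t, ht⟩
    · simp
    · exfalso
      refine (hT t ht).2.2 ((hq t).unique ?_)
      simp_rw [hconst]
      exact hasDerivAt_const t y
  · have hinj : Set.InjOn (fun t : ℝ => Complex.exp (t * Complex.I)) T := by
      intro s hs t ht hst
      have hs' := (hT s hs).1
      have ht' := (hT t ht).1
      have := congrArg Complex.arg hst
      simp only [Complex.arg_exp_mul_I] at this
      rw [toIocMod_eq_self Real.two_pi_pos |>.mpr, toIocMod_eq_self Real.two_pi_pos |>.mpr] at this
      · exact this
      · convert ht' using 1; ring_nf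
      · convert hs' using 1; ring_nf
    rw [← Finset.card_image_of_injOn hinj]
    refine le_trans ?_ ((Polynomial.card_roots' p).trans hdeg)
    refine le_trans (Finset.card_le_card (t := p.roots.toFinset) ?_) (Multiset.toFinset_card_le _)
    intro z hz
    obtain ⟨t, ht, rfl⟩ := Finset.mem_image.mp hz
    rw [Multiset.mem_toFinset, Polynomial.mem_roots hp0, Polynomial.IsRoot, heval t,
      (hT t ht).2.1]
    simp

/-- `θ ↦ P(A, cos θ, sin θ)`. -/
noncomputable def Pang (n d : ℕ) (A : MatTuple n d) (θ : ℝ) : Matrix (Fin n) (Fin n) ℝ :=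
  Pmat n d A (Real.cos θ) (Real.sin θ)

/-- The norm of the vector of monomials of degree `d` at `(cos θ, sin θ)`. -/
noncomputable def monNorm (d : ℕ) (θ : ℝ) : ℝ :=
  √(∑ k ∈ Finset.range (d + 1), Real.cos θ ^ (2 * k) * Real.sin θ ^ (2 * (d - k)))

/-- The Frobenius norm. -/
noncomputable def frob {n : ℕ} (X : Matrix (Fin n) (Fin n) ℝ) : ℝ := √(∑ i, ∑ j, X i j ^ 2)

/-- The norm of the gradient of `A ↦ det P(A, cos θ, sin θ)`. -/
noncomputable def gradNorm (n d : ℕ) (A : MatTuple n d) (θ : ℝ) : ℝ :=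
  monNorm d θ * frob (Pang n d A θ).adjugate

/-- The smoothed Kac sum `(1/2ε) ∫ 1{|det P| < ε} ‖∇ det P‖`. -/
noncomputable def kacSum (n d : ℕ) (A : MatTuple n d) (ε : ℝ) : ℝ≥0∞ :=
  (ENNReal.ofReal (2 * ε))⁻¹ * ∫⁻ θ in Set.Ioo 0 π,
    {θ | |(Pang n d A θ).det| < ε}.indicator (fun θ => ENNReal.ofReal (gradNorm n d A θ)) θ

lemma Pmat_apply (n d : ℕ) (A : MatTuple n d) (α β : ℝ) (j k : Fin n) :
    Pmat n d A α β j k = ∑ i : Fin (d + 1), α ^ (i : ℕ) * β ^ (d - (i : ℕ)) * A i j k := by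
  simp [Pmat, Matrix.sum_apply]

lemma continuous_Pang (n d : ℕ) :
    Continuous fun p : MatTuple n d × ℝ => Pang n d p.1 p.2 := by
  refine continuous_matrix fun j k => ?_
  simp only [Pang, Pmat_apply]
  fun_prop

lemma continuous_Pang_left (n d : ℕ) (θ : ℝ) : Continuous fun A : MatTuple n d => Pang n d A θ := by
  refine continuous_matrix fun j k => ?_
  simp only [Pang, Pmat_apply]
  fun_prop

lemma continuous_det_Pang (n d : ℕ) :
    Continuous fun p : MatTuple n d × ℝ => (Pang n d p.1 p.2).det :=
  (continuous_Pang n d).matrix_det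

lemma continuous_monNorm (d : ℕ) : Continuous (monNorm d) := by
  unfold monNorm
  fun_prop

lemma continuous_gradNorm (n d : ℕ) :
    Continuous fun p : MatTuple n d × ℝ => gradNorm n d p.1 p.2 := by
  refine ((continuous_monNorm d).comp continuous_snd).mul ?_
  unfold frob
  have h := (continuous_Pang n d).matrix_adjugate
  refine Real.continuous_sqrt.comp ?_
  refine continuous_finsetSum _ fun i _ => continuous_finsetSum _ fun j _ => ?_
  exact (h.matrix_elem i j).pow 2

lemma continuous_gradNorm_left (n d : ℕ) (θ : ℝ) :
    Continuous fun A : MatTuple n d => gradNorm n d A θ := by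
  have h : Continuous fun A : MatTuple n d => (A, θ) := by fun_prop
  simpa only [Function.comp_def] using (continuous_gradNorm n d).comp h

/-- `A ↦ P(A, cos θ, sin θ)` is linear. -/
lemma Pang_smul_add_smul (n d : ℕ) (A B : MatTuple n d) (θ a b : ℝ) :
    Pang n d (a • A + b • B) θ = a • Pang n d A θ + b • Pang n d B θ := by
  ext j k
  simp only [Pang, Pmat_apply, Pi.add_apply, Pi.smul_apply, smul_eq_mul, Matrix.add_apply,
    Matrix.smul_apply, Finset.mul_sum, ← Finset.sum_add_distrib]
  exact Finset.sum_congr rfl fun i _ => by ring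

/-- The differential of `det P(·, cos θ, sin θ)` at `A`. -/
noncomputable def detDiff (n d : ℕ) (θ : ℝ) (A : MatTuple n d) : StrongDual ℝ (MatTuple n d) :=
  LinearMap.toContinuousLinearMap
    { toFun := fun B => ((Pang n d A θ).adjugate * Pang n d B θ).trace
      map_add' := fun B C => by
        have := Pang_smul_add_smul n d B C θ 1 1
        simp only [one_smul] at this
        rw [this, Matrix.mul_add, Matrix.trace_add]
      map_smul' := fun a B => by
        have := Pang_smul_add_smul n d B 0 θ a 0
        simp only [zero_smul, add_zero] at this
        rw [this, Matrix.mul_smul, Matrix.trace_smul]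
        rfl }

lemma detDiff_apply (n d : ℕ) (θ : ℝ) (A B : MatTuple n d) :
    detDiff n d θ A B = ((Pang n d A θ).adjugate * Pang n d B θ).trace := rfl

lemma continuous_detDiff (n d : ℕ) (θ : ℝ) :
    Continuous fun p : MatTuple n d × MatTuple n d => detDiff n d θ p.1 p.2 := by
  simp only [detDiff_apply]
  have h1 : Continuous fun p : MatTuple n d × MatTuple n d => Pang n d p.1 θ :=
    (continuous_Pang_left n d θ).comp continuous_fst
  have h2 : Continuous fun p : MatTuple n d × MatTuple n d => Pang n d p.2 θ :=
    (continuous_Pang_left n d θ).comp continuous_snd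
  exact (h1.matrix_adjugate.matrix_mul h2).matrix_trace

lemma norm_detDiff (n d : ℕ) (θ : ℝ) (A : MatTuple n d) :
    √(∑ i, ∑ j, ∑ k, (detDiff n d θ A (Pi.single i (Pi.single j (Pi.single k 1)))) ^ 2) =
      gradNorm n d A θ := by
  have h1 : ∀ (i : Fin (d + 1)) (j k : Fin n),
      detDiff n d θ A (Pi.single i (Pi.single j (Pi.single k 1))) =
        Real.cos θ ^ (i : ℕ) * Real.sin θ ^ (d - (i : ℕ)) * (Pang n d A θ).adjugate k j := by
    intro i j k
    have : Pang n d (Pi.single i (Pi.single j (Pi.single k 1))) θ =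
        Matrix.single j k (Real.cos θ ^ (i : ℕ) * Real.sin θ ^ (d - (i : ℕ))) := by
      ext a b
      rw [Pang, Pmat_apply, Finset.sum_eq_single i]
      · rw [Pi.single_eq_same, Matrix.single_apply]
        by_cases ha : a = j
        · subst ha
          by_cases hb : b = k
          · subst hb; simp
          · simp [hb, Ne.symm hb]
        · simp [ha, Ne.symm ha]
      · intro c _ hc
        simp [Pi.single_eq_of_ne hc]
      · simp
    rw [detDiff_apply, this, Matrix.trace_mul_single, op_smul_eq_mul, mul_comm]
  simp_rw [h1, mul_pow]
  rw [gradNorm, monNorm, frob, ← Real.sqrt_mul (Finset.sum_nonneg fun k _ => by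
    rw [pow_mul, pow_mul]; positivity)]
  congr 1
  rw [Finset.sum_range, Finset.sum_mul]
  refine Finset.sum_congr rfl fun i _ => ?_
  rw [Finset.sum_comm, Finset.mul_sum]
  refine Finset.sum_congr rfl fun k _ => ?_
  rw [Finset.mul_sum]
  refine Finset.sum_congr rfl fun j _ => ?_
  ring

lemma lintegral_indicator_gradNorm_le (n d : ℕ) (θ : ℝ) {ε : ℝ} (hε : 0 < ε) :
    ∫⁻ A, {A | |(Pang n d A θ).det| < ε}.indicator
        (fun A => ENNReal.ofReal (gradNorm n d A θ)) A ∂gaussTuple n d ≤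
      ENNReal.ofReal (√(π / 2) * (2 * n * ε / π)) := by
  set γ := gaussTuple n d with hγ
  have hdc : Continuous fun A : MatTuple n d => (Pang n d A θ).det :=
    (continuous_Pang_left n d θ).matrix_det
  have hsm : MeasurableSet {A : MatTuple n d | |(Pang n d A θ).det| < ε} :=
    (isOpen_lt hdc.abs continuous_const).measurableSet
  set S : Set (MatTuple n d × MatTuple n d) := {p | |(Pang n d p.1 θ).det| < ε} with hS
  have hSm : MeasurableSet S := measurable_fst hsm
  set H : MatTuple n d × MatTuple n d → ℝ≥0∞ :=
    S.indicator fun p => ENNReal.ofReal |detDiff n d θ p.1 p.2| with hH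
  have hHm : Measurable H :=
    (ENNReal.measurable_ofReal.comp (continuous_detDiff n d θ).abs.measurable).indicator hSm
  have h1 : ∫⁻ p, H p ∂(γ.prod γ) = ENNReal.ofReal √(2 / π) *
      ∫⁻ A, {A | |(Pang n d A θ).det| < ε}.indicator
        (fun A => ENNReal.ofReal (gradNorm n d A θ)) A ∂γ := by
    rw [lintegral_prod _ hHm.aemeasurable, ← lintegral_const_mul]
    · refine lintegral_congr fun A => ?_
      by_cases hA : |(Pang n d A θ).det| < ε
      · have : ∀ B, H (A, B) = ENNReal.ofReal |detDiff n d θ A B| := fun B =>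
          Set.indicator_of_mem (show (A, B) ∈ S from hA) _
        simp_rw [this]
        rw [lintegral_abs_dual_gaussTuple, norm_detDiff, Set.indicator_of_mem (by exact hA),
          ENNReal.ofReal_mul (Real.sqrt_nonneg _)]
      · have : ∀ B, H (A, B) = 0 := fun B =>
          Set.indicator_of_notMem (show (A, B) ∉ S from hA) _
        simp_rw [this]
        rw [Set.indicator_of_notMem (by exact hA)]
        simp
    · refine Measurable.indicator ?_ hsm
      exact ENNReal.measurable_ofReal.comp
        (continuous_gradNorm_left n d θ).measurable
  set R : ℝ → MatTuple n d × MatTuple n d → MatTuple n d × MatTuple n d := fun t p =>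
    (Real.cos t • p.1 + Real.sin t • p.2, -Real.sin t • p.1 + Real.cos t • p.2) with hR
  have hRc : Continuous fun x : ℝ × (MatTuple n d × MatTuple n d) => R x.1 x.2 := by
    simp only [hR]
    fun_prop
  have h2 : ∀ t, ∫⁻ p, H (R t p) ∂(γ.prod γ) = ∫⁻ p, H p ∂(γ.prod γ) := by
    intro t
    conv_rhs => rw [← gaussTuple_prod_map_rotation n d t]
    rw [lintegral_map hHm (ContinuousLinearMap.continuous _).measurable]
    refine lintegral_congr fun p => ?_
    rw [ContinuousLinearMap.rotation_apply]
  have h3 : ∀ p, ∫⁻ t in Set.Ioc (-π) π, H (R t p) ≤ ENNReal.ofReal (4 * n * ε) := by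
    rintro ⟨A, B⟩
    set q : ℝ → ℝ := fun t => (Real.cos t • Pang n d A θ + Real.sin t • Pang n d B θ).det with hq
    set q' : ℝ → ℝ := fun t => detDiff n d θ (R t (A, B)).1 (R t (A, B)).2 with hq'
    have hqd : ∀ t, HasDerivAt q (q' t) t := by
      intro t
      simp only [hq, hq', hR, detDiff_apply, Pang_smul_add_smul]
      refine hasDerivAt_det fun i j => ?_
      simp only [Matrix.add_apply, Matrix.smul_apply, smul_eq_mul]
      exact ((Real.hasDerivAt_cos t).mul_const _).add ((Real.hasDerivAt_sin t).mul_const _)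
    have hqc : Continuous q' := by
      have h : Continuous fun t => R t (A, B) := by simp only [hR]; fun_prop
      exact (continuous_detDiff n d θ).comp h
    have hqq : Continuous q := continuous_iff_continuousAt.mpr fun t => (hqd t).continuousAt
    have := lintegral_abs_deriv_le_of_card_le hqd hqc (measurableSet_Ioc (a := -π) (b := π))
      (fun y T hT => card_level_det_rotation_le _ _ hqd y T hT)
      (measurableSet_Ioo (a := -ε) (b := ε))
    calc ∫⁻ t in Set.Ioc (-π) π, H (R t (A, B))
        = ∫⁻ t in Set.Ioc (-π) π ∩ q ⁻¹' Set.Ioo (-ε) ε, ENNReal.ofReal |q' t| := by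
          rw [Set.inter_comm, ← Measure.restrict_restrict (hqq.measurable measurableSet_Ioo),
            ← lintegral_indicator (hqq.measurable measurableSet_Ioo)]
          refine lintegral_congr fun t => ?_
          have hmem : R t (A, B) ∈ S ↔ t ∈ q ⁻¹' Set.Ioo (-ε) ε := by
            simp only [hS, hR, hq, Set.mem_ofPred_eq, Pang_smul_add_smul, Set.mem_preimage,
              Set.mem_Ioo, abs_lt]
          simp only [hH, Set.indicator_apply, hmem, hq']
      _ ≤ (2 * n : ℕ) * volume (Set.Ioo (-ε) ε) := this
      _ = ENNReal.ofReal (4 * n * ε) := by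
          rw [Real.volume_Ioo, ← ENNReal.ofReal_natCast, ← ENNReal.ofReal_mul (by positivity)]
          congr 1
          push_cast
          ring
  have h4 : ENNReal.ofReal (2 * π) * ∫⁻ p, H p ∂(γ.prod γ) ≤ ENNReal.ofReal (4 * n * ε) := by
    calc ENNReal.ofReal (2 * π) * ∫⁻ p, H p ∂(γ.prod γ)
        = ∫⁻ t in Set.Ioc (-π) π, ∫⁻ p, H (R t p) ∂(γ.prod γ) := by
          simp_rw [h2]
          rw [setLIntegral_const, Real.volume_Ioc, mul_comm]
          congr 2
          ring
      _ = ∫⁻ p, (∫⁻ t in Set.Ioc (-π) π, H (R t p)) ∂(γ.prod γ) :=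
          lintegral_lintegral_swap (hHm.comp hRc.measurable).aemeasurable
      _ ≤ ∫⁻ _, ENNReal.ofReal (4 * n * ε) ∂(γ.prod γ) := lintegral_mono h3
      _ = ENNReal.ofReal (4 * n * ε) := by simp
  rw [h1, ← mul_assoc, ← ENNReal.ofReal_mul (by positivity)] at h4
  set c := 2 * π * √(2 / π) with hc
  have hc0 : 0 < c := by positivity
  have h5 : ENNReal.ofReal (4 * n * ε) =
      ENNReal.ofReal c * ENNReal.ofReal (√(π / 2) * (2 * n * ε / π)) := by
    rw [← ENNReal.ofReal_mul hc0.le]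
    congr 1
    have : √(2 / π) * √(π / 2) = 1 := by
      rw [← Real.sqrt_mul (by positivity)]
      have : 2 / π * (π / 2) = 1 := by field_simp
      rw [this, Real.sqrt_one]
    have h6 : c * (√(π / 2) * (2 * n * ε / π)) =
        2 * π * (2 * n * ε / π) * (√(2 / π) * √(π / 2)) := by rw [hc]; ring
    rw [h6, this]
    field_simp
    ring
  rw [h5] at h4
  exact (ENNReal.mul_le_mul_iff_right (by simpa using hc0) ENNReal.ofReal_ne_top).mp h4

lemma measurable_indicator_gradNorm (n d : ℕ) (ε : ℝ) :
    Measurable fun p : MatTuple n d × ℝ => {θ | |(Pang n d p.1 θ).det| < ε}.indicator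
      (fun θ => ENNReal.ofReal (gradNorm n d p.1 θ)) p.2 := by
  have hm : MeasurableSet {p : MatTuple n d × ℝ | |(Pang n d p.1 p.2).det| < ε} :=
    (isOpen_lt (continuous_det_Pang n d).abs continuous_const).measurableSet
  exact (ENNReal.measurable_ofReal.comp (continuous_gradNorm n d).measurable).indicator hm

lemma measurable_kacSum (n d : ℕ) (ε : ℝ) : Measurable fun A => kacSum n d A ε :=
  (measurable_indicator_gradNorm n d ε).lintegral_prod_right'.const_mul _

lemma lintegral_kacSum_le (n d : ℕ) {ε : ℝ} (hε : 0 < ε) :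
    ∫⁻ A, kacSum n d A ε ∂gaussTuple n d ≤ ENNReal.ofReal (n * √(π / 2)) := by
  unfold kacSum
  rw [lintegral_const_mul _ (measurable_indicator_gradNorm n d ε).lintegral_prod_right',
    lintegral_lintegral_swap (measurable_indicator_gradNorm n d ε).aemeasurable]
  have h : ∫⁻ θ in Set.Ioo 0 π, ∫⁻ A, {θ | |(Pang n d A θ).det| < ε}.indicator
      (fun θ => ENNReal.ofReal (gradNorm n d A θ)) θ ∂gaussTuple n d ≤
      ENNReal.ofReal (2 * ε) * ENNReal.ofReal (n * √(π / 2)) := by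
    calc _ ≤ ∫⁻ θ in Set.Ioo 0 π, ENNReal.ofReal (√(π / 2) * (2 * n * ε / π)) :=
          lintegral_mono fun θ => lintegral_indicator_gradNorm_le n d θ hε
      _ = _ := by
          rw [setLIntegral_const, Real.volume_Ioo, ← ENNReal.ofReal_mul (by positivity),
            ← ENNReal.ofReal_mul (by positivity)]
          congr 1
          field_simp
          ring
  calc _ ≤ (ENNReal.ofReal (2 * ε))⁻¹ *
        (ENNReal.ofReal (2 * ε) * ENNReal.ofReal (n * √(π / 2))) := by gcongr
    _ = _ := by
      rw [← mul_assoc, ENNReal.inv_mul_cancel (by simpa using hε) ENNReal.ofReal_ne_top, one_mul]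

lemma pi_withDensity {ι : Type*} [Fintype ι] {E : ι → Type*} [∀ i, MeasurableSpace (E i)]
    (μ : ∀ i, Measure (E i)) [∀ i, IsProbabilityMeasure (μ i)] {w : ∀ i, E i → ℝ≥0∞}
    (hw : ∀ i, Measurable (w i)) [∀ i, SigmaFinite ((μ i).withDensity (w i))] :
    Measure.pi (fun i => (μ i).withDensity (w i)) =
      (Measure.pi μ).withDensity fun x => ∏ i, w i (x i) := by
  refine Measure.pi_eq fun s hs => ?_
  rw [withDensity_apply _ (MeasurableSet.univ_pi hs),
    ← lintegral_indicator (MeasurableSet.univ_pi hs)]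
  have h1 : ∀ x : ∀ i, E i, (Set.univ.pi s).indicator (fun x => ∏ i, w i (x i)) x =
      ∏ i, (s i).indicator (w i) (x i) := by
    intro x
    by_cases hx : x ∈ Set.univ.pi s
    · rw [Set.indicator_of_mem hx]
      exact Finset.prod_congr rfl fun i _ =>
        (Set.indicator_of_mem (hx i (Set.mem_univ i)) _).symm
    · rw [Set.indicator_of_notMem hx]
      simp only [Set.mem_pi, Set.mem_univ, true_implies, not_forall] at hx
      obtain ⟨i, hi⟩ := hx
      exact (Finset.prod_eq_zero (Finset.mem_univ i) (Set.indicator_of_notMem hi _)).symm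
  simp_rw [h1]
  have hm : ∀ i, Measurable ((s i).indicator (w i)) := fun i => (hw i).indicator (hs i)
  rw [lintegral_prod_eq_prod_lintegral_of_indepFun Finset.univ
    (fun i (x : ∀ i, E i) => (s i).indicator (w i) (x i))
    (iIndepFun_pi fun i => (hm i).aemeasurable) fun i => (hm i).comp (measurable_pi_apply i)]
  refine Finset.prod_congr rfl fun i _ => ?_
  rw [withDensity_apply _ (hs i), ← lintegral_indicator (hs i)]
  exact (measurePreserving_eval μ i).lintegral_comp (hm i)

lemma gaussTuple_withDensity (n d : ℕ) {w : ℝ → ℝ≥0∞} (hw : Measurable w)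
    [SigmaFinite ((gaussianReal 0 1).withDensity w)] :
    (Measure.pi fun _ : Fin (d + 1) => Measure.pi fun _ : Fin n => Measure.pi fun _ : Fin n =>
      (gaussianReal 0 1).withDensity w) =
      (gaussTuple n d).withDensity fun A => ∏ i, ∏ j, ∏ k, w (A i j k) := by
  have h1 := pi_withDensity (fun _ : Fin n => gaussianReal 0 1) (w := fun _ => w) fun _ => hw
  have s1 : SigmaFinite ((Measure.pi fun _ : Fin n => gaussianReal 0 1).withDensity
      fun x => ∏ i, w (x i)) := by rw [← h1]; infer_instance
  have m1 : Measurable fun x : Fin n → ℝ => ∏ i, w (x i) := by fun_prop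
  have h2 := pi_withDensity (fun _ : Fin n => Measure.pi fun _ : Fin n => gaussianReal 0 1)
    (w := fun _ x => ∏ i, w (x i)) fun _ => m1
  have s2 : SigmaFinite ((Measure.pi fun _ : Fin n => Measure.pi fun _ : Fin n =>
      gaussianReal 0 1).withDensity fun x => ∏ j, ∏ i, w (x j i)) := by
    rw [← h2]; infer_instance
  have m2 : Measurable fun x : Fin n → Fin n → ℝ => ∏ j, ∏ i, w (x j i) := by fun_prop
  have h3 := pi_withDensity (fun _ : Fin (d + 1) => Measure.pi fun _ : Fin n =>
    Measure.pi fun _ : Fin n => gaussianReal 0 1) (w := fun _ x => ∏ j, ∏ i, w (x j i)) fun _ => m2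
  rw [gaussTuple, ← h3, ← h2, ← h1]

lemma gaussTuple_absolutelyContinuous (n d : ℕ) : gaussTuple n d ≪ volume := by
  have hm : Measurable fun x : ℝ => (gaussianPDF 0 1 x)⁻¹ := (measurable_gaussianPDF 0 1).inv
  have hv : (gaussianReal 0 1).withDensity (fun x => (gaussianPDF 0 1 x)⁻¹) = volume := by
    rw [gaussianReal_of_var_ne_zero _ one_ne_zero]
    refine withDensity_inv_same (measurable_gaussianPDF 0 1) ?_ ?_
    · exact ae_of_all _ fun x => (gaussianPDF_pos 0 one_ne_zero x).ne'
    · exact ae_of_all _ fun x => ENNReal.ofReal_ne_top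
  have hs : SigmaFinite ((gaussianReal 0 1).withDensity fun x => (gaussianPDF 0 1 x)⁻¹) := by
    rw [hv]; infer_instance
  have h := gaussTuple_withDensity n d hm
  rw [hv] at h
  have hvol : (volume : Measure (MatTuple n d)) =
      (gaussTuple n d).withDensity fun A => ∏ i, ∏ j, ∏ k, (gaussianPDF 0 1 (A i j k))⁻¹ := h
  rw [hvol]
  refine withDensity_absolutelyContinuous' ?_ ?_
  · exact Measurable.aemeasurable (by fun_prop)
  · refine ae_of_all _ fun A => ?_
    refine Finset.prod_ne_zero_iff.mpr fun i _ => Finset.prod_ne_zero_iff.mpr fun j _ =>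
      Finset.prod_ne_zero_iff.mpr fun k _ => ?_
    exact ENNReal.inv_ne_zero.mpr ENNReal.ofReal_ne_top

lemma tnorm_sq (n d : ℕ) (A : MatTuple n d) :
    tnorm n d A ^ 2 = ∑ i, ∑ j, ∑ k, A i j k ^ 2 :=
  Real.sq_sqrt (Finset.sum_nonneg fun _ _ => Finset.sum_nonneg fun _ _ =>
    Finset.sum_nonneg fun _ _ => sq_nonneg _)

/-- Weighting the Gaussian measure by `exp (-s‖A‖²/2)` amounts to rescaling it. -/
lemma lintegral_mul_exp_gaussTuple (n d : ℕ) {s : ℝ} (hs : 0 ≤ s) {F : MatTuple n d → ℝ≥0∞}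
    (hF : Measurable F) :
    ∫⁻ A, ENNReal.ofReal (rexp (-(s * (tnorm n d A ^ 2 / 2)))) * F A ∂gaussTuple n d =
      ENNReal.ofReal ((1 + s) ^ (-(((d : ℝ) + 1) * (n : ℝ) ^ 2 / 2))) *
        ∫⁻ A, F ((√(1 + s))⁻¹ • A) ∂gaussTuple n d := by
  have h1s : 0 < 1 + s := by linarith
  set w : ℝ → ℝ≥0∞ := fun x => ENNReal.ofReal (√(1 + s) * rexp (-(s * (x ^ 2 / 2)))) with hw
  have hwm : Measurable w := by fun_prop
  set c : ℝ := (√(1 + s))⁻¹ with hc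
  have h1 : (gaussianReal 0 1).withDensity w = (gaussianReal 0 1).map (fun x => c * x) := by
    set v : NNReal := NNReal.mk (c ^ 2) (sq_nonneg c) with hv
    have hcs : c ^ 2 = (1 + s)⁻¹ := by rw [hc, inv_pow, Real.sq_sqrt h1s.le]
    have hv0 : v ≠ 0 := by
      intro h
      have := congrArg NNReal.toReal h
      simp only [hv, NNReal.coe_mk, hcs, NNReal.coe_zero] at this
      exact (inv_pos.mpr h1s).ne' this
    rw [gaussianReal_map_const_mul, mul_zero, mul_one,
      gaussianReal_of_var_ne_zero 0 one_ne_zero, gaussianReal_of_var_ne_zero 0 hv0,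
      ← withDensity_mul _ (measurable_gaussianPDF 0 1) hwm]
    congr 1
    ext x
    rw [Pi.mul_apply, gaussianPDF, gaussianPDF, hw, ← ENNReal.ofReal_mul (gaussianPDFReal_nonneg _ _ _)]
    congr 1
    simp only [gaussianPDFReal, NNReal.coe_one, mul_one, sub_zero, hv, NNReal.coe_mk, hcs]
    have e1 : rexp (-x ^ 2 / 2) * rexp (-(s * (x ^ 2 / 2))) =
        rexp (-x ^ 2 / (2 * (1 + s)⁻¹)) := by
      rw [← Real.exp_add]
      congr 1
      field_simp
      ring
    rw [Real.sqrt_mul (by positivity) ((1 + s)⁻¹), Real.sqrt_inv, ← e1, mul_inv, inv_inv]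
    ring
  have s1 : SigmaFinite ((gaussianReal 0 1).withDensity w) := by
    rw [h1]
    have := Measure.isProbabilityMeasure_map (μ := gaussianReal 0 1)
      (f := fun x : ℝ => c * x) (by fun_prop)
    infer_instance
  have h2 := gaussTuple_withDensity n d hwm
  rw [h1] at h2
  have p1 := Measure.isProbabilityMeasure_map (μ := gaussianReal 0 1)
    (f := fun x : ℝ => c * x) (by fun_prop)
  have h3 : (Measure.pi fun _ : Fin (d + 1) => Measure.pi fun _ : Fin n =>
      Measure.pi fun _ : Fin n => (gaussianReal 0 1).map (fun x => c * x)) =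
      (gaussTuple n d).map (fun A => c • A) := by
    have a1 := Measure.pi_map_pi (μ := fun _ : Fin n => gaussianReal 0 1)
      (f := fun _ x => c * x) fun _ => Measurable.aemeasurable (by fun_prop)
    have p2 := Measure.isProbabilityMeasure_map (μ := Measure.pi fun _ : Fin n => gaussianReal 0 1)
      (f := fun x i => c * x i) (Measurable.aemeasurable (by fun_prop))
    have a2 := Measure.pi_map_pi (μ := fun _ : Fin n => Measure.pi fun _ : Fin n => gaussianReal 0 1)
      (f := fun _ x i => c * x i) fun _ => Measurable.aemeasurable (by fun_prop)
    have p3 := Measure.isProbabilityMeasure_map (μ := Measure.pi fun _ : Fin n =>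
      Measure.pi fun _ : Fin n => gaussianReal 0 1)
      (f := fun x i j => c * x i j) (Measurable.aemeasurable (by fun_prop))
    have a3 := Measure.pi_map_pi (μ := fun _ : Fin (d + 1) => Measure.pi fun _ : Fin n =>
      Measure.pi fun _ : Fin n => gaussianReal 0 1)
      (f := fun _ x i j => c * x i j) fun _ => Measurable.aemeasurable (by fun_prop)
    rw [← a1, ← a2, ← a3]
    rfl
  rw [h3] at h2
  have hcm : Measurable fun A : MatTuple n d => c • A := by fun_prop
  rw [← lintegral_map hF hcm, h2, lintegral_withDensity_eq_lintegral_mul _ (by fun_prop) hF,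
    ← lintegral_const_mul]
  · refine lintegral_congr fun A => ?_
    rw [Pi.mul_apply, ← mul_assoc]
    congr 1
    have e2 : ∏ i, ∏ j, ∏ k, w (A i j k) = ENNReal.ofReal
        ((1 + s) ^ (((d : ℝ) + 1) * (n : ℝ) ^ 2 / 2) *
          rexp (-(s * (tnorm n d A ^ 2 / 2)))) := by
      simp only [hw]
      have q0 : ∀ x : ℝ, 0 ≤ √(1 + s) * rexp (-(s * (x ^ 2 / 2))) := fun x => by positivity
      simp_rw [← ENNReal.ofReal_prod_of_nonneg fun _ _ => q0 _]
      simp_rw [← ENNReal.ofReal_prod_of_nonneg fun _ _ => Finset.prod_nonneg fun _ _ => q0 _]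
      rw [← ENNReal.ofReal_prod_of_nonneg fun _ _ => Finset.prod_nonneg fun _ _ =>
        Finset.prod_nonneg fun _ _ => q0 _]
      congr 1
      simp_rw [Finset.prod_mul_distrib, ← Real.exp_sum, Finset.prod_const, Finset.card_univ,
        Fintype.card_fin]
      congr 1
      · rw [← pow_mul, ← pow_mul, Real.sqrt_eq_rpow, ← Real.rpow_natCast, ← Real.rpow_mul h1s.le]
        congr 1
        push_cast
        ring
      · rw [tnorm_sq]
        congr 1
        simp_rw [Finset.sum_neg_distrib, ← Finset.mul_sum, Finset.sum_div]
    rw [e2, ← ENNReal.ofReal_mul (by positivity), ← mul_assoc, ← Real.rpow_add h1s,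
      neg_add_cancel, Real.rpow_zero, one_mul]
  · exact Measurable.mul (by fun_prop) hF

lemma lintegral_rpow_mul_exp_neg_mul {a b : ℝ} (ha : 0 < a) (hb : 0 < b) :
    ∫⁻ t in Set.Ioi (0 : ℝ), ENNReal.ofReal (t ^ (a - 1) * rexp (-(b * t))) =
      ENNReal.ofReal ((1 / b) ^ a * Real.Gamma a) := by
  have h := Real.integral_rpow_mul_exp_neg_mul_Ioi ha hb
  have hpos : 0 < (1 / b) ^ a * Real.Gamma a := by
    have := Real.Gamma_pos_of_pos ha
    positivity
  rw [← h, ofReal_integral_eq_lintegral_ofReal]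
  · exact not_imp_comm.mp integral_undef (by rw [h]; exact hpos.ne')
  · filter_upwards [ae_restrict_mem measurableSet_Ioi] with t ht
    have : 0 < t := ht
    positivity

lemma lintegral_beta {a : ℝ} (ha : 1 / 2 < a) :
    ∫⁻ s in Set.Ioi (0 : ℝ), ENNReal.ofReal (s ^ ((1 / 2 : ℝ) - 1)) *
        ENNReal.ofReal ((1 + s) ^ (-a)) =
      ENNReal.ofReal (√π * Real.Gamma (a - 1 / 2) / Real.Gamma a) := by
  have ha0 : 0 < a := by linarith
  have hG := Real.Gamma_pos_of_pos ha0
  have h1 : ∀ s ∈ Set.Ioi (0 : ℝ), ENNReal.ofReal (s ^ ((1 / 2 : ℝ) - 1)) *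
      ENNReal.ofReal ((1 + s) ^ (-a)) = ENNReal.ofReal (Real.Gamma a)⁻¹ *
        ∫⁻ t in Set.Ioi (0 : ℝ), ENNReal.ofReal (s ^ ((1 / 2 : ℝ) - 1) *
          (t ^ (a - 1) * rexp (-((1 + s) * t)))) := by
    intro s hs
    have hs0 : 0 < s := hs
    simp_rw [ENNReal.ofReal_mul (Real.rpow_nonneg hs0.le _)]
    rw [lintegral_const_mul _ (by fun_prop)]
    have := lintegral_rpow_mul_exp_neg_mul ha0 (show 0 < 1 + s by linarith)
    rw [this, mul_left_comm]
    congr 1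
    rw [← ENNReal.ofReal_mul (by positivity)]
    congr 1
    rw [one_div, Real.inv_rpow (by linarith), Real.rpow_neg (by linarith)]
    field_simp
  rw [setLIntegral_congr_fun measurableSet_Ioi h1, lintegral_const_mul, lintegral_lintegral_swap]
  · have h2 : ∀ t ∈ Set.Ioi (0 : ℝ), ∫⁻ s in Set.Ioi (0 : ℝ),
        ENNReal.ofReal (s ^ ((1 / 2 : ℝ) - 1) * (t ^ (a - 1) * rexp (-((1 + s) * t)))) =
        ENNReal.ofReal √π * ENNReal.ofReal (t ^ ((a - 1 / 2) - 1) * rexp (-(1 * t))) := by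
      intro t ht
      have ht0 : 0 < t := ht
      have e : ∀ s : ℝ, ENNReal.ofReal (s ^ ((1 / 2 : ℝ) - 1) *
          (t ^ (a - 1) * rexp (-((1 + s) * t)))) =
          ENNReal.ofReal (t ^ (a - 1) * rexp (-t)) *
            ENNReal.ofReal (s ^ ((1 / 2 : ℝ) - 1) * rexp (-(t * s))) := by
        intro s
        rw [← ENNReal.ofReal_mul (by positivity)]
        congr 1
        rw [show -((1 + s) * t) = -t + -(t * s) by ring, Real.exp_add]
        ring
      simp_rw [e]
      rw [lintegral_const_mul _ (by fun_prop), lintegral_rpow_mul_exp_neg_mul (by norm_num) ht0,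
        ← ENNReal.ofReal_mul (by positivity), ← ENNReal.ofReal_mul (by positivity),
        Real.Gamma_one_half_eq]
      congr 1
      rw [one_div t, Real.inv_rpow ht0.le, ← Real.rpow_neg ht0.le,
        show a - 1 / 2 - 1 = (a - 1) + -(1 / 2) by ring, Real.rpow_add ht0, one_mul]
      ring
    rw [setLIntegral_congr_fun measurableSet_Ioi h2, lintegral_const_mul _ (by fun_prop),
      lintegral_rpow_mul_exp_neg_mul (by linarith) one_pos,
      ← ENNReal.ofReal_mul (by positivity), ← ENNReal.ofReal_mul (by positivity)]
    congr 1
    rw [div_one, Real.one_rpow]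
    field_simp
  · refine Measurable.aemeasurable ?_
    unfold Function.uncurry
    fun_prop
  · exact Measurable.lintegral_prod_right' (f := fun p : ℝ × ℝ => ENNReal.ofReal
      (p.1 ^ ((1 / 2 : ℝ) - 1) * (p.2 ^ (a - 1) * rexp (-((1 + p.1) * p.2))))) (by fun_prop)

lemma tnorm_smul (n d : ℕ) (A : MatTuple n d) {c : ℝ} (hc : 0 ≤ c) :
    tnorm n d (c • A) = c * tnorm n d A := by
  simp only [tnorm, Pi.smul_apply, smul_eq_mul, mul_pow, ← Finset.mul_sum]
  rw [Real.sqrt_mul (sq_nonneg c), Real.sqrt_sq hc]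

lemma Pang_smul (n d : ℕ) (A : MatTuple n d) (c θ : ℝ) : Pang n d (c • A) θ = c • Pang n d A θ := by
  simpa using Pang_smul_add_smul n d A 0 θ c 0

lemma gradNorm_smul (n d : ℕ) (A : MatTuple n d) {c : ℝ} (hc : 0 ≤ c) (θ : ℝ) :
    gradNorm n d (c • A) θ = c ^ (n - 1) * gradNorm n d A θ := by
  simp only [gradNorm, frob, Pang_smul, Matrix.adjugate_smul, Fintype.card_fin, Matrix.smul_apply,
    smul_eq_mul, mul_pow, ← Finset.mul_sum]
  rw [Real.sqrt_mul (by positivity), Real.sqrt_sq (by positivity)]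
  ring

lemma kacSum_smul (n d : ℕ) (hn : 1 ≤ n) (A : MatTuple n d) {c : ℝ} (hc : 0 < c) {ε : ℝ}
    (hε : 0 < ε) : kacSum n d (c • A) ε = ENNReal.ofReal c⁻¹ * kacSum n d A (ε / c ^ n) := by
  have hcn : 0 < c ^ n := by positivity
  have h1 : ∀ θ, {θ | |(Pang n d (c • A) θ).det| < ε}.indicator
      (fun θ => ENNReal.ofReal (gradNorm n d (c • A) θ)) θ =
      ENNReal.ofReal (c ^ (n - 1)) * {θ | |(Pang n d A θ).det| < ε / c ^ n}.indicator
        (fun θ => ENNReal.ofReal (gradNorm n d A θ)) θ := by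
    intro θ
    have : |(Pang n d (c • A) θ).det| < ε ↔ |(Pang n d A θ).det| < ε / c ^ n := by
      rw [Pang_smul, Matrix.det_smul, Fintype.card_fin, abs_mul, abs_of_pos hcn, lt_div_iff₀ hcn,
        mul_comm]
    simp only [Set.indicator_apply, Set.mem_ofPred_eq, this]
    split_ifs
    · rw [gradNorm_smul _ _ _ hc.le, ENNReal.ofReal_mul (by positivity)]
    · rw [mul_zero]
  have hm : Measurable fun θ => {θ | |(Pang n d A θ).det| < ε / c ^ n}.indicator
      (fun θ => ENNReal.ofReal (gradNorm n d A θ)) θ := by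
    have h : Measurable fun θ : ℝ => (A, θ) := measurable_prodMk_left
    simpa only [Function.comp_def] using (measurable_indicator_gradNorm n d _).comp h
  unfold kacSum
  simp_rw [h1]
  rw [lintegral_const_mul _ hm, ← mul_assoc, ← mul_assoc]
  congr 1
  rw [← ENNReal.ofReal_inv_of_pos (by positivity), ← ENNReal.ofReal_inv_of_pos (by positivity),
    ← ENNReal.ofReal_mul (by positivity), ← ENNReal.ofReal_mul (by positivity)]
  congr 1
  obtain ⟨m, rfl⟩ := Nat.exists_eq_add_of_le' hn
  rw [Nat.add_sub_cancel, pow_succ]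
  field_simp

lemma continuous_tnorm (n d : ℕ) : Continuous (tnorm n d) := by
  unfold tnorm
  fun_prop

lemma tnorm_nonneg (n d : ℕ) (A : MatTuple n d) : 0 ≤ tnorm n d A := Real.sqrt_nonneg _

/-- Averaging the rescaled smoothed Kac sums removes the factor `‖A‖`. -/
lemma lintegral_rpow_mul_lintegral_exp_le (n d : ℕ) {ε : ℝ} (hε : 0 < ε) :
    ∫⁻ s in Set.Ioi (0 : ℝ), ENNReal.ofReal (s ^ ((1 / 2 : ℝ) - 1)) *
      ∫⁻ A, ENNReal.ofReal (rexp (-(s * (tnorm n d A ^ 2 / 2)))) *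
        (ENNReal.ofReal (tnorm n d A) * kacSum n d A ε) ∂gaussTuple n d ≤
      ENNReal.ofReal (n * π) := by
  have hk := measurable_kacSum n d ε
  have ht := (continuous_tnorm n d).measurable
  have h1 : ∀ A, ∫⁻ s in Set.Ioi (0 : ℝ), ENNReal.ofReal (s ^ ((1 / 2 : ℝ) - 1)) *
      (ENNReal.ofReal (rexp (-(s * (tnorm n d A ^ 2 / 2)))) *
        (ENNReal.ofReal (tnorm n d A) * kacSum n d A ε)) ≤
      ENNReal.ofReal √(2 * π) * kacSum n d A ε := by
    intro A
    rcases (tnorm_nonneg n d A).eq_or_lt with h0 | h0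
    · simp [← h0]
    set r := tnorm n d A with hr
    have e : ∀ s : ℝ, ENNReal.ofReal (s ^ ((1 / 2 : ℝ) - 1)) *
        (ENNReal.ofReal (rexp (-(s * (r ^ 2 / 2)))) * (ENNReal.ofReal r * kacSum n d A ε)) =
        (ENNReal.ofReal r * kacSum n d A ε) * (ENNReal.ofReal (rexp (-(r ^ 2 / 2 * s))) *
          ENNReal.ofReal (s ^ ((1 / 2 : ℝ) - 1))) := by
      intro s
      rw [mul_comm s]
      ring
    simp_rw [e, ← ENNReal.ofReal_mul (Real.exp_pos _).le]
    rw [lintegral_const_mul _ (by fun_prop)]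
    have := lintegral_rpow_mul_exp_neg_mul (show (0 : ℝ) < 1 / 2 by norm_num)
      (show 0 < r ^ 2 / 2 by positivity)
    simp_rw [mul_comm (_ ^ ((1 / 2 : ℝ) - 1))] at this
    rw [this, mul_comm (ENNReal.ofReal r), mul_assoc, ← ENNReal.ofReal_mul h0.le, mul_comm]
    refine le_of_eq ?_
    congr 2
    rw [Real.Gamma_one_half_eq, ← Real.sqrt_eq_rpow, one_div_div, Real.sqrt_div (by norm_num),
      Real.sqrt_sq h0.le, Real.sqrt_mul (by norm_num)]
    field_simp
  have hm : Measurable fun p : ℝ × MatTuple n d => ENNReal.ofReal (p.1 ^ ((1 / 2 : ℝ) - 1)) *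
      (ENNReal.ofReal (rexp (-(p.1 * (tnorm n d p.2 ^ 2 / 2)))) *
        (ENNReal.ofReal (tnorm n d p.2) * kacSum n d p.2 ε)) := by
    fun_prop
  calc _ = ∫⁻ s in Set.Ioi (0 : ℝ), ∫⁻ A, ENNReal.ofReal (s ^ ((1 / 2 : ℝ) - 1)) *
      (ENNReal.ofReal (rexp (-(s * (tnorm n d A ^ 2 / 2)))) *
        (ENNReal.ofReal (tnorm n d A) * kacSum n d A ε)) ∂gaussTuple n d := by
        refine lintegral_congr fun s => ?_
        rw [lintegral_const_mul _ (by fun_prop)]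
    _ = ∫⁻ A, (∫⁻ s in Set.Ioi (0 : ℝ), ENNReal.ofReal (s ^ ((1 / 2 : ℝ) - 1)) *
      (ENNReal.ofReal (rexp (-(s * (tnorm n d A ^ 2 / 2)))) *
        (ENNReal.ofReal (tnorm n d A) * kacSum n d A ε))) ∂gaussTuple n d :=
        lintegral_lintegral_swap hm.aemeasurable
    _ ≤ ∫⁻ A, ENNReal.ofReal √(2 * π) * kacSum n d A ε ∂gaussTuple n d := lintegral_mono h1
    _ ≤ ENNReal.ofReal √(2 * π) * ENNReal.ofReal (n * √(π / 2)) := by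
        rw [lintegral_const_mul _ hk]
        gcongr
        exact lintegral_kacSum_le n d hε
    _ = ENNReal.ofReal (n * π) := by
        rw [← ENNReal.ofReal_mul (by positivity)]
        congr 1
        rw [mul_left_comm, ← Real.sqrt_mul (by positivity),
          show 2 * π * (π / 2) = π ^ 2 by ring, Real.sqrt_sq Real.pi_pos.le]

/-- The Kac-type lower bound implies the expectation bound. -/
lemma lintegral_muTotal_le_of_kac (n d : ℕ) (hn : 1 ≤ n) (hd : 1 ≤ d)
    (h : ∀ᵐ A ∂gaussTuple n d, ∀ ε : ℕ → ℝ, (∀ k, 0 < ε k) →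
      Filter.Tendsto ε Filter.atTop (nhds 0) → muTotal n d A ≤ ENNReal.ofReal (tnorm n d A) *
        Filter.liminf (fun k => kacSum n d A (ε k)) Filter.atTop) :
    ∫⁻ A, muTotal n d A ∂(gaussTuple n d) ≤
      ENNReal.ofReal
        (Real.sqrt π * (n : ℝ) *
          (Real.Gamma ((((d : ℝ) + 1) * (n : ℝ) ^ 2) / 2) /
            Real.Gamma ((((d : ℝ) + 1) * (n : ℝ) ^ 2 - 1) / 2))) := by
  set E := ∫⁻ A, muTotal n d A ∂(gaussTuple n d) with hE
  set a : ℝ := ((d : ℝ) + 1) * (n : ℝ) ^ 2 / 2 with ha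
  have hn' : (1 : ℝ) ≤ n := by exact_mod_cast hn
  have hd' : (1 : ℝ) ≤ d := by exact_mod_cast hd
  have ha1 : 1 ≤ a := by
    rw [ha]
    nlinarith [one_le_pow₀ (n := 2) hn']
  have ht := (continuous_tnorm n d).measurable
  have hmF : ∀ ε, Measurable fun A => ENNReal.ofReal (tnorm n d A) * kacSum n d A ε := by
    intro ε
    have := measurable_kacSum n d ε
    fun_prop
  have hfatou : ∀ ε : ℕ → ℝ, (∀ k, 0 < ε k) → Filter.Tendsto ε Filter.atTop (nhds 0) →
      E ≤ Filter.liminf (fun k => ∫⁻ A, ENNReal.ofReal (tnorm n d A) * kacSum n d A (ε k)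
        ∂gaussTuple n d) Filter.atTop := by
    intro ε hε hlim
    refine le_trans (lintegral_mono_ae ?_) (lintegral_liminf_le fun k => hmF (ε k))
    filter_upwards [h] with A hA
    refine (hA ε hε hlim).trans (le_of_eq ?_)
    exact (ENNReal.liminf_const_mul_of_ne_top ENNReal.ofReal_ne_top).symm
  set Φ : ℕ → ℝ → ℝ≥0∞ := fun k s => ∫⁻ A, ENNReal.ofReal (rexp (-(s * (tnorm n d A ^ 2 / 2)))) *
    (ENNReal.ofReal (tnorm n d A) * kacSum n d A (1 / ((k : ℝ) + 1))) ∂gaussTuple n d with hΦ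
  have hΦm : ∀ k, Measurable (Φ k) := by
    intro k
    have := measurable_kacSum n d (1 / ((k : ℝ) + 1))
    exact Measurable.lintegral_prod_right' (f := fun p : ℝ × MatTuple n d =>
      ENNReal.ofReal (rexp (-(p.1 * (tnorm n d p.2 ^ 2 / 2)))) *
        (ENNReal.ofReal (tnorm n d p.2) * kacSum n d p.2 (1 / ((k : ℝ) + 1)))) (by fun_prop)
  have hΦlow : ∀ s ∈ Set.Ioi (0 : ℝ), ENNReal.ofReal ((1 + s) ^ (-a)) * E ≤
      Filter.liminf (fun k => Φ k s) Filter.atTop := by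
    intro s hs
    have hs0 : 0 < s := hs
    have h1s : 0 < √(1 + s) := Real.sqrt_pos.mpr (by linarith)
    set c := (√(1 + s))⁻¹ with hc
    have hc0 : 0 < c := inv_pos.mpr h1s
    have e : ∀ k, Φ k s = ENNReal.ofReal ((1 + s) ^ (-a)) *
        ∫⁻ A, ENNReal.ofReal (tnorm n d A) * kacSum n d A (1 / ((k : ℝ) + 1) / c ^ n)
          ∂gaussTuple n d := by
      intro k
      rw [hΦ]
      dsimp only
      rw [lintegral_mul_exp_gaussTuple n d hs0.le (hmF _)]
      congr 1
      refine lintegral_congr fun A => ?_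
      rw [kacSum_smul n d hn A hc0 (by positivity), tnorm_smul n d A hc0.le, ← mul_assoc,
        ← ENNReal.ofReal_mul (mul_nonneg hc0.le (tnorm_nonneg n d A))]
      congr 2
      field_simp
    simp_rw [e]
    rw [ENNReal.liminf_const_mul_of_ne_top ENNReal.ofReal_ne_top]
    gcongr
    refine hfatou _ (fun k => by positivity) ?_
    have := (tendsto_one_div_add_atTop_nhds_zero_nat (𝕜 := ℝ)).div_const (c ^ n)
    simpa using this
  have hmain : E * ENNReal.ofReal (√π * Real.Gamma (a - 1 / 2) / Real.Gamma a) ≤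
      ENNReal.ofReal (n * π) := by
    rw [← lintegral_beta (by linarith), ← lintegral_const_mul _ (by fun_prop)]
    calc ∫⁻ s in Set.Ioi (0 : ℝ), E * (ENNReal.ofReal (s ^ ((1 / 2 : ℝ) - 1)) *
          ENNReal.ofReal ((1 + s) ^ (-a)))
        ≤ ∫⁻ s in Set.Ioi (0 : ℝ), Filter.liminf (fun k =>
            ENNReal.ofReal (s ^ ((1 / 2 : ℝ) - 1)) * Φ k s) Filter.atTop := by
          refine setLIntegral_mono' measurableSet_Ioi fun s hs => ?_
          rw [ENNReal.liminf_const_mul_of_ne_top ENNReal.ofReal_ne_top, mul_left_comm]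
          gcongr
          rw [mul_comm]
          exact hΦlow s hs
      _ ≤ Filter.liminf (fun k => ∫⁻ s in Set.Ioi (0 : ℝ),
            ENNReal.ofReal (s ^ ((1 / 2 : ℝ) - 1)) * Φ k s) Filter.atTop :=
          lintegral_liminf_le fun k => Measurable.mul (by fun_prop) (hΦm k)
      _ ≤ ENNReal.ofReal (n * π) := by
          refine Filter.liminf_le_of_frequently_le' (Filter.Frequently.of_forall fun k => ?_)
          exact lintegral_rpow_mul_lintegral_exp_le n d (by positivity)
  have hG1 := Real.Gamma_pos_of_pos (show 0 < a - 1 / 2 by linarith)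
  have hG2 := Real.Gamma_pos_of_pos (show 0 < a by linarith)
  have hq : 0 < √π * Real.Gamma (a - 1 / 2) / Real.Gamma a := by positivity
  rw [← ENNReal.le_div_iff_mul_le (Or.inl (by simpa using hq)) (Or.inl ENNReal.ofReal_ne_top),
    ← ENNReal.ofReal_div_of_pos hq] at hmain
  refine hmain.trans (le_of_eq ?_)
  congr 1
  rw [show (((d : ℝ) + 1) * (n : ℝ) ^ 2 - 1) / 2 = a - 1 / 2 by rw [ha]; ring]
  field_simp
  rw [Real.sq_sqrt Real.pi_pos.le]

/-- The vector with `j`-th entry `1` and other entries read off column `j` of `B i₀`. -/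
noncomputable def kerVec {n d : ℕ} (i₀ : Fin (d + 1)) (j : Fin n) (B : MatTuple n d) : Fin n → ℝ :=
  fun k => if k = j then 1 else B i₀ k j

/-- Replaces column `j` of `B i₀` so that `kerVec i₀ j B` lies in the kernel of
`∑ i, m i (B i₀ j j) • B i`. -/
noncomputable def colSolve {n d : ℕ} (m : Fin (d + 1) → ℝ → ℝ) (i₀ : Fin (d + 1)) (j : Fin n)
    (B : MatTuple n d) : MatTuple n d :=
  fun i a k => if i = i₀ ∧ k = j then
    -((m i₀ (B i₀ j j))⁻¹ * ∑ p : Fin (d + 1) × Fin n, if p.1 = i₀ ∧ p.2 = j then 0 else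
      m p.1 (B i₀ j j) * B p.1 a p.2 * kerVec i₀ j B p.2) else B i a k

section

variable {n d : ℕ} (m m' : Fin (d + 1) → ℝ → ℝ) (i₀ : Fin (d + 1)) (j : Fin n)

lemma colSolve_spec (B : MatTuple n d) (h : m i₀ (B i₀ j j) ≠ 0) (a : Fin n) :
    ∑ p : Fin (d + 1) × Fin n,
      m p.1 (B i₀ j j) * colSolve m i₀ j B p.1 a p.2 * kerVec i₀ j B p.2 = 0 := by
  set S := ∑ p : Fin (d + 1) × Fin n, if p.1 = i₀ ∧ p.2 = j then 0 else
      m p.1 (B i₀ j j) * B p.1 a p.2 * kerVec i₀ j B p.2 with hS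
  have e : ∀ p : Fin (d + 1) × Fin n,
      m p.1 (B i₀ j j) * colSolve m i₀ j B p.1 a p.2 * kerVec i₀ j B p.2 =
      (if p = (i₀, j) then -S else 0) + (if p.1 = i₀ ∧ p.2 = j then 0 else
      m p.1 (B i₀ j j) * B p.1 a p.2 * kerVec i₀ j B p.2) := by
    rintro ⟨i, k⟩
    by_cases hp : i = i₀ ∧ k = j
    · obtain ⟨rfl, rfl⟩ := hp
      simp only [colSolve, and_self, if_true, kerVec, mul_one, add_zero]
      rw [mul_neg, mul_inv_cancel_left₀ h]
      rfl
    · simp [colSolve, hp, Prod.ext_iff]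
  rw [Finset.sum_congr rfl fun p _ => e p, Finset.sum_add_distrib, ← hS]
  simp

lemma differentiableAt_colSolve (hm : ∀ i t, HasDerivAt (m i) (m' i t) t) (B : MatTuple n d)
    (h : m i₀ (B i₀ j j) ≠ 0) : DifferentiableAt ℝ (colSolve m i₀ j) B := by
  have hm' : ∀ i, Differentiable ℝ (m i) := fun i t => (hm i t).differentiableAt
  have hk : ∀ k, DifferentiableAt ℝ (fun B : MatTuple n d => kerVec i₀ j B k) B := by
    intro k
    unfold kerVec
    split_ifs <;> fun_prop
  have hc : ∀ i, DifferentiableAt ℝ (fun B : MatTuple n d => m i (B i₀ j j)) B := by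
    intro i
    fun_prop
  refine differentiableAt_pi.2 fun i => differentiableAt_pi.2 fun a => differentiableAt_pi.2
    fun k => ?_
  unfold colSolve
  split_ifs
  · refine (((hc i₀).inv h).mul (DifferentiableAt.fun_sum fun p _ => ?_)).neg
    split_ifs
    · fun_prop
    · exact ((hc _).mul (by fun_prop)).mul (hk _)
  · fun_prop

lemma fderiv_colSolve_eq_zero (hm : ∀ i t, HasDerivAt (m i) (m' i t) t) (B : MatTuple n d)
    (h : m i₀ (B i₀ j j) ≠ 0) (c : ℝ) (r : Fin n → ℝ) (hr : r j = 0)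
    (hcr : ∀ a, ∑ p : Fin (d + 1) × Fin n,
      (c * m' p.1 (B i₀ j j) * colSolve m i₀ j B p.1 a p.2 * kerVec i₀ j B p.2 +
        m p.1 (B i₀ j j) * colSolve m i₀ j B p.1 a p.2 * r p.2) = 0) :
    fderiv ℝ (colSolve m i₀ j) B
      (fun i a k => if i = i₀ ∧ k = j then (if a = j then c else r a) else 0) = 0 := by
  set E : MatTuple n d :=
    fun i a k => if i = i₀ ∧ k = j then (if a = j then c else r a) else 0 with hE
  set D := fderiv ℝ (colSolve m i₀ j) B E with hD
  have hγ : HasDerivAt (fun s : ℝ => B + s • E) E 0 := by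
    simpa using ((hasDerivAt_id (0 : ℝ)).smul_const E).const_add B
  have hγ0 : B + (0 : ℝ) • E = B := by simp
  have hA : HasDerivAt (fun s : ℝ => colSolve m i₀ j (B + s • E)) D 0 := by
    have := (differentiableAt_colSolve m m' i₀ j hm B h).hasFDerivAt
    rw [← hγ0] at this
    have h2 := this.comp_hasDerivAt (0 : ℝ) hγ
    rw [hγ0] at h2
    exact h2
  have hA' : ∀ i a k, HasDerivAt (fun s : ℝ => colSolve m i₀ j (B + s • E) i a k) (D i a k) 0 :=
    fun i a k => hasDerivAt_pi.1 (hasDerivAt_pi.1 (hasDerivAt_pi.1 hA i) a) k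
  have hD0 : ∀ i a k, ¬ (i = i₀ ∧ k = j) → D i a k = 0 := by
    intro i a k hik
    refine (hA' i a k).unique ?_
    have : (fun s : ℝ => colSolve m i₀ j (B + s • E) i a k) = fun _ => B i a k := by
      funext s
      simp [colSolve, hik, hE]
    rw [this]
    exact hasDerivAt_const _ _
  have ht : ∀ s : ℝ, (B + s • E) i₀ j j = B i₀ j j + s * c := by
    intro s
    simp [hE]
  have hk : ∀ s : ℝ, kerVec i₀ j (B + s • E) = fun k => kerVec i₀ j B k + s * r k := by
    intro s
    funext k
    by_cases hkj : k = j
    · simp [kerVec, hkj, hr]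
    · simp [kerVec, hkj, hE]
  have hcol : ∀ a, D i₀ a j = 0 := by
    intro a
    have h1 : HasDerivAt (fun s : ℝ => ∑ p : Fin (d + 1) × Fin n,
        m p.1 (B i₀ j j + s * c) * colSolve m i₀ j (B + s • E) p.1 a p.2 *
          (kerVec i₀ j B p.2 + s * r p.2))
        (∑ p : Fin (d + 1) × Fin n,
          ((m' p.1 (B i₀ j j) * c * colSolve m i₀ j B p.1 a p.2 +
            m p.1 (B i₀ j j) * D p.1 a p.2) * kerVec i₀ j B p.2 +
            m p.1 (B i₀ j j) * colSolve m i₀ j B p.1 a p.2 * r p.2)) 0 := by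
      refine HasDerivAt.fun_sum fun p _ => ?_
      have e1 : HasDerivAt (fun s : ℝ => m p.1 (B i₀ j j + s * c)) (m' p.1 (B i₀ j j) * c) 0 := by
        have hl : HasDerivAt (fun s : ℝ => B i₀ j j + s * c) c 0 := by
          simpa using ((hasDerivAt_id (0 : ℝ)).mul_const c).const_add (B i₀ j j)
        have := (hm p.1 (B i₀ j j + 0 * c)).comp (0 : ℝ) hl
        simpa [Function.comp_def] using this
      have e2 : HasDerivAt (fun s : ℝ => kerVec i₀ j B p.2 + s * r p.2) (r p.2) 0 := by
        simpa using ((hasDerivAt_id (0 : ℝ)).mul_const (r p.2)).const_add (kerVec i₀ j B p.2)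
      have := (e1.fun_mul (hA' p.1 a p.2)).fun_mul e2
      simpa using this
    have h2 : HasDerivAt (fun s : ℝ => ∑ p : Fin (d + 1) × Fin n,
        m p.1 (B i₀ j j + s * c) * colSolve m i₀ j (B + s • E) p.1 a p.2 *
          (kerVec i₀ j B p.2 + s * r p.2)) 0 0 := by
      refine (hasDerivAt_const (0 : ℝ) (0 : ℝ)).congr_of_eventuallyEq ?_
      have hcont : ContinuousAt (fun s : ℝ => m i₀ (B i₀ j j + s * c)) 0 := by
        have : Continuous (m i₀) :=
          continuous_iff_continuousAt.2 fun t => (hm i₀ t).continuousAt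
        fun_prop
      have hne : ∀ᶠ s : ℝ in nhds 0, m i₀ (B i₀ j j + s * c) ≠ 0 :=
        hcont.eventually_ne (by simpa using h)
      filter_upwards [hne] with s hs
      have := colSolve_spec m i₀ j (B + s • E) (by rwa [ht]) a
      rw [ht, hk] at this
      exact this
    have h3 := h1.unique h2
    have h4 : ∑ p : Fin (d + 1) × Fin n, m p.1 (B i₀ j j) * D p.1 a p.2 * kerVec i₀ j B p.2 = 0 := by
      rw [← h3, ← sub_eq_zero, ← Finset.sum_sub_distrib, ← neg_eq_zero, ← Finset.sum_neg_distrib,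
        ← hcr a]
      refine Finset.sum_congr rfl fun p _ => ?_
      ring
    rw [Finset.sum_eq_single (i₀, j)] at h4
    · simpa [kerVec, h] using h4
    · rintro ⟨i, k⟩ - hp
      rw [hD0 i a k (by simpa [Prod.ext_iff] using hp)]
      ring
    · simp
  funext i a k
  by_cases hp : i = i₀ ∧ k = j
  · obtain ⟨rfl, rfl⟩ := hp
    exact hcol a
  · exact hD0 i a k hp

lemma isAddHaarMeasure_volume_matTuple (n d : ℕ) :
    (volume : Measure (MatTuple n d)).IsAddHaarMeasure := by
  have h1 : (volume : Measure (Fin n → ℝ)).IsAddHaarMeasure := inferInstance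
  have h2 : (volume : Measure (Fin n → Fin n → ℝ)).IsAddHaarMeasure := by
    rw [volume_pi]
    infer_instance
  have h3 : MeasurableAdd (Fin n → Fin n → ℝ) := inferInstance
  have h4 : SigmaFinite (volume : Measure (Fin n → Fin n → ℝ)) := inferInstance
  rw [volume_pi]
  exact Measure.pi.isAddHaarMeasure _

/-- A Sard-type statement: for almost every tuple, `∑ i, m i t • A i` and its kernel vector move
transversally. -/
lemma ae_transversal (hm : ∀ i t, HasDerivAt (m i) (m' i t) t) :
    ∀ᵐ A : MatTuple n d, ∀ t, m i₀ t ≠ 0 → ∀ r : Fin n → ℝ, r ≠ 0 →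
      (∀ a, ∑ p : Fin (d + 1) × Fin n, m p.1 t * A p.1 a p.2 * r p.2 = 0) →
      ∀ (c : ℝ) (r' : Fin n → ℝ),
      (∀ a, ∑ p : Fin (d + 1) × Fin n,
        (c * m' p.1 t * A p.1 a p.2 * r p.2 + m p.1 t * A p.1 a p.2 * r' p.2) = 0) →
      c = 0 ∧ ∃ x : ℝ, r' = x • r := by
  have := isAddHaarMeasure_volume_matTuple n d
  set S : Fin n → Set (MatTuple n d) := fun j =>
    {B | m i₀ (B i₀ j j) ≠ 0 ∧ (fderiv ℝ (colSolve m i₀ j) B).det = 0} with hS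
  have hnull : ∀ j, (volume : Measure (MatTuple n d)) (colSolve m i₀ j '' S j) = 0 := by
    intro j
    exact addHaar_image_eq_zero_of_det_fderivWithin_eq_zero _
      (fun B hB => (differentiableAt_colSolve m m' i₀ j hm B hB.1).hasFDerivAt.hasFDerivWithinAt)
      fun B hB => hB.2
  have hnull' : (volume : Measure (MatTuple n d)) (⋃ j, colSolve m i₀ j '' S j) = 0 :=
    measure_iUnion_null hnull
  refine measure_mono_null ?_ hnull'
  intro A hA
  by_contra hcon
  refine hA ?_
  intro t ht r hr hker c r' hcr
  obtain ⟨j, hj⟩ := Function.ne_iff.1 hr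
  have hj : r j ≠ 0 := hj
  by_contra hbad
  refine hcon (Set.mem_iUnion.2 ⟨j, ?_⟩)
  set B : MatTuple n d := fun i a k => if i = i₀ ∧ k = j then (if a = j then t else r a / r j)
    else A i a k with hB
  have hBt : B i₀ j j = t := by simp [hB]
  have hBr : kerVec i₀ j B = fun k => r k / r j := by
    funext k
    by_cases hk : k = j
    · simp [kerVec, hk, hj]
    · simp [kerVec, hk, hB]
  have hAB : colSolve m i₀ j B = A := by
    funext i a k
    by_cases hp : i = i₀ ∧ k = j
    · obtain ⟨rfl, rfl⟩ := hp
      have h1 := hker a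
      have e : ∀ p : Fin (d + 1) × Fin n, m p.1 t * A p.1 a p.2 * r p.2 =
          (if p = (i, k) then m i t * A i a k * r k else 0) +
          r k * (if p.1 = i ∧ p.2 = k then 0 else
            m p.1 (B i k k) * B p.1 a p.2 * kerVec i k B p.2) := by
        rintro ⟨i', k'⟩
        by_cases hp : i' = i ∧ k' = k
        · obtain ⟨rfl, rfl⟩ := hp
          simp
        · simp only [Prod.ext_iff, hp, if_false, zero_add, hBt, hBr]
          simp only [hB, hp, if_false]
          field_simp
      rw [Finset.sum_congr rfl fun p _ => e p, Finset.sum_add_distrib, ← Finset.mul_sum] at h1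
      simp only [Finset.sum_ite_eq', Finset.mem_univ, if_true] at h1
      simp only [colSolve, and_self, if_true]
      set T := ∑ p : Fin (d + 1) × Fin n, if p.1 = i ∧ p.2 = k then 0 else
            m p.1 (B i k k) * B p.1 a p.2 * kerVec i k B p.2
      rw [hBt]
      have h2 : T = -(m i t * A i a k) := by
        refine mul_left_cancel₀ hj ?_
        linarith
      rw [h2]
      field_simp
    · simp [colSolve, hp, hB]
  refine ⟨B, ⟨by rwa [hBt], ?_⟩, hAB⟩
  set q : Fin n → ℝ := fun k => (r' k - r' j / r j * r k) / r j with hq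
  have hqj : q j = 0 := by
    simp only [hq]
    field_simp
    ring
  have hzero := fderiv_colSolve_eq_zero m m' i₀ j hm B (by rwa [hBt]) c q hqj (by
    intro a
    rw [hAB, hBt, hBr]
    have h1 := hker a
    have h2 := hcr a
    have : ∑ p : Fin (d + 1) × Fin n, (c * m' p.1 t * A p.1 a p.2 * (r p.2 / r j) +
        m p.1 t * A p.1 a p.2 * q p.2) =
        (r j)⁻¹ * ∑ p : Fin (d + 1) × Fin n,
        (c * m' p.1 t * A p.1 a p.2 * r p.2 + m p.1 t * A p.1 a p.2 * r' p.2) -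
        (r' j / r j / r j) * ∑ p : Fin (d + 1) × Fin n, m p.1 t * A p.1 a p.2 * r p.2 := by
      rw [Finset.mul_sum, Finset.mul_sum, ← Finset.sum_sub_distrib]
      refine Finset.sum_congr rfl fun p _ => ?_
      simp only [hq]
      field_simp
      ring
    rw [this, h1, h2]
    ring)
  by_contra hdet
  have hinj : Function.Injective (fderiv ℝ (colSolve m i₀ j) B) := by
    have hu : IsUnit (LinearMap.det (fderiv ℝ (colSolve m i₀ j) B : MatTuple n d →ₗ[ℝ] MatTuple n d)) :=
      isUnit_iff_ne_zero.2 hdet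
    exact (LinearEquiv.ofIsUnitDet (f := (fderiv ℝ (colSolve m i₀ j) B : MatTuple n d →ₗ[ℝ] MatTuple n d))
      (v := Module.finBasis ℝ _) (v' := Module.finBasis ℝ _)
      (by rwa [LinearMap.det_toMatrix])).injective
  have hE := hinj (hzero.trans (map_zero _).symm)
  refine hbad ⟨?_, r' j / r j, ?_⟩
  · simpa using congrFun (congrFun (congrFun hE i₀) j) j
  · funext k
    have hk : q k = 0 := by
      by_cases hkj : k = j
      · rw [hkj, hqj]
      · simpa [hkj] using congrFun (congrFun (congrFun hE i₀) k) j
    simp only [hq, div_eq_zero_iff, hj, or_false] at hk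
    simp only [Pi.smul_apply, smul_eq_mul]
    linarith

end

section

variable {ι : Type*} [Fintype ι] [DecidableEq ι] {M : Matrix ι ι ℝ} {r ℓ : ι → ℝ}

omit [DecidableEq ι] in
lemma dotProduct_vecMulVec_mulVec (x y u v : ι → ℝ) :
    u ⬝ᵥ (Matrix.vecMulVec x y *ᵥ v) = (u ⬝ᵥ x) * (y ⬝ᵥ v) := by
  rw [Matrix.vecMulVec_mulVec]
  simp [dotProduct, Finset.sum_mul, mul_assoc]

lemma det_add_vecMulVec_ne_zero (hr : r ≠ 0) (hℓ : ℓ ≠ 0)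
    (hker : ∀ x, M *ᵥ x = 0 → ∃ a : ℝ, x = a • r) (hℓM : ℓ ᵥ* M = 0) :
    (M + Matrix.vecMulVec ℓ r).det ≠ 0 := by
  intro h
  obtain ⟨x, hx0, hx⟩ := Matrix.exists_mulVec_eq_zero_iff.2 h
  have h1 : ℓ ⬝ᵥ ((M + Matrix.vecMulVec ℓ r) *ᵥ x) = 0 := by rw [hx, dotProduct_zero]
  rw [Matrix.add_mulVec, dotProduct_add, Matrix.dotProduct_mulVec, hℓM, zero_dotProduct, zero_add,
    dotProduct_vecMulVec_mulVec] at h1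
  have hrx : r ⬝ᵥ x = 0 :=
    (mul_eq_zero.1 h1).resolve_left (by simpa [dotProduct_self_eq_zero] using hℓ)
  rw [Matrix.add_mulVec, Matrix.vecMulVec_mulVec, hrx] at hx
  obtain ⟨a, rfl⟩ := hker x (by simpa using hx)
  rw [dotProduct_smul, smul_eq_mul] at hrx
  rcases mul_eq_zero.1 hrx with ha | ha
  · simp [ha] at hx0
  · exact hr (dotProduct_self_eq_zero.1 ha)

lemma exists_mulVec_eq_of_dotProduct_eq_zero (hr : r ≠ 0) (hℓ : ℓ ≠ 0)
    (hker : ∀ x, M *ᵥ x = 0 → ∃ a : ℝ, x = a • r) (hℓM : ℓ ᵥ* M = 0) {y : ι → ℝ}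
    (hy : ℓ ⬝ᵥ y = 0) : ∃ x, M *ᵥ x = y := by
  have hN := det_add_vecMulVec_ne_zero hr hℓ hker hℓM
  set N := M + Matrix.vecMulVec ℓ r with hNdef
  have hx : N *ᵥ (N⁻¹ *ᵥ y) = y := by
    rw [Matrix.mulVec_mulVec, Matrix.mul_nonsing_inv _ (isUnit_iff_ne_zero.2 hN), Matrix.one_mulVec]
  set x := N⁻¹ *ᵥ y
  refine ⟨x, ?_⟩
  have h1 : ℓ ⬝ᵥ (N *ᵥ x) = 0 := by rw [hx, hy]
  rw [hNdef, Matrix.add_mulVec, dotProduct_add, Matrix.dotProduct_mulVec, hℓM, zero_dotProduct,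
    zero_add, dotProduct_vecMulVec_mulVec] at h1
  have hrx : r ⬝ᵥ x = 0 :=
    (mul_eq_zero.1 h1).resolve_left (by simpa [dotProduct_self_eq_zero] using hℓ)
  rw [hNdef, Matrix.add_mulVec, Matrix.vecMulVec_mulVec, hrx] at hx
  simpa using hx

lemma eq_smul_of_vecMul_eq_zero (hr : r ≠ 0) (hℓ : ℓ ≠ 0)
    (hker : ∀ x, M *ᵥ x = 0 → ∃ a : ℝ, x = a • r) (hℓM : ℓ ᵥ* M = 0) {y : ι → ℝ}
    (hy : y ᵥ* M = 0) : ∃ a : ℝ, y = a • ℓ := by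
  have hN := det_add_vecMulVec_ne_zero hr hℓ hker hℓM
  have hℓℓ : ℓ ⬝ᵥ ℓ ≠ 0 := by simpa [dotProduct_self_eq_zero] using hℓ
  refine ⟨(y ⬝ᵥ ℓ) / (ℓ ⬝ᵥ ℓ), ?_⟩
  by_contra hne
  refine hN (Matrix.exists_vecMul_eq_zero_iff.1
    ⟨y - ((y ⬝ᵥ ℓ) / (ℓ ⬝ᵥ ℓ)) • ℓ, sub_ne_zero.2 hne, ?_⟩)
  rw [Matrix.vecMul_add, Matrix.vecMul_vecMulVec, Matrix.sub_vecMul, Matrix.smul_vecMul, hy, hℓM,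
    sub_dotProduct, smul_dotProduct, smul_eq_mul, div_mul_cancel₀ _ hℓℓ]
  simp

lemma adjugate_ne_zero_of_ker (hr : r ≠ 0) (hMr : M *ᵥ r = 0)
    (hker : ∀ x, M *ᵥ x = 0 → ∃ a : ℝ, x = a • r) : M.adjugate ≠ 0 := by
  have hdet : M.det = 0 := Matrix.exists_mulVec_eq_zero_iff.1 ⟨r, hr, hMr⟩
  obtain ⟨ℓ, hℓ, hℓM⟩ := Matrix.exists_vecMul_eq_zero_iff.2 hdet
  have hN := det_add_vecMulVec_ne_zero hr hℓ hker hℓM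
  set N := M + Matrix.vecMulVec ℓ r with hNdef
  have hrr : r ⬝ᵥ r ≠ 0 := by simpa [dotProduct_self_eq_zero] using hr
  have hNinv : N⁻¹ *ᵥ ℓ = (r ⬝ᵥ r)⁻¹ • r := by
    have h1 : N *ᵥ r = (r ⬝ᵥ r) • ℓ := by
      rw [hNdef, Matrix.add_mulVec, hMr, Matrix.vecMulVec_mulVec]
      simp
    have h2 : N⁻¹ *ᵥ (N *ᵥ r) = r := by
      rw [Matrix.mulVec_mulVec, Matrix.nonsing_inv_mul _ (isUnit_iff_ne_zero.2 hN),
        Matrix.one_mulVec]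
    rw [h1, Matrix.mulVec_smul] at h2
    rw [eq_inv_smul_iff₀ hrr, h2]
  have hline : ∀ t : ℝ, (M + t • Matrix.vecMulVec ℓ r).det = t * N.det := by
    intro t
    have e : M + t • Matrix.vecMulVec ℓ r = N * (1 + Matrix.vecMulVec ((t - 1) • (N⁻¹ *ᵥ ℓ)) r) := by
      rw [Matrix.mul_add, Matrix.mul_one, Matrix.mul_vecMulVec, Matrix.mulVec_smul,
        Matrix.mulVec_mulVec, Matrix.mul_nonsing_inv _ (isUnit_iff_ne_zero.2 hN),
        Matrix.one_mulVec, Matrix.smul_vecMulVec, hNdef, sub_smul, one_smul]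
      abel
    rw [e, Matrix.det_mul, Matrix.vecMulVec_eq Unit, Matrix.det_one_add_replicateCol_mul_replicateRow,
      hNinv, dotProduct_smul, dotProduct_smul, smul_eq_mul, smul_eq_mul, inv_mul_cancel₀ hrr]
    ring
  intro hadj
  have h1 : HasDerivAt (fun t : ℝ => (M + t • Matrix.vecMulVec ℓ r).det) 0 0 := by
    have := hasDerivAt_det (X := fun t : ℝ => M + t • Matrix.vecMulVec ℓ r)
      (X' := Matrix.vecMulVec ℓ r) (t := 0) (fun i j => by
        simpa using ((hasDerivAt_id (0 : ℝ)).mul_const (Matrix.vecMulVec ℓ r i j)).const_add (M i j))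
    simpa [hadj] using this
  simp only [hline] at h1
  have h2 : HasDerivAt (fun t : ℝ => t * N.det) N.det 0 := by
    simpa using (hasDerivAt_id (0 : ℝ)).mul_const N.det
  exact hN (h2.unique h1)

lemma exists_adjugate_eq_vecMulVec (hr : r ≠ 0) (hℓ : ℓ ≠ 0) (hMr : M *ᵥ r = 0)
    (hker : ∀ x, M *ᵥ x = 0 → ∃ a : ℝ, x = a • r) (hℓM : ℓ ᵥ* M = 0) :
    ∃ c : ℝ, c ≠ 0 ∧ M.adjugate = c • Matrix.vecMulVec r ℓ := by
  have hdet : M.det = 0 := Matrix.exists_mulVec_eq_zero_iff.1 ⟨r, hr, hMr⟩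
  have hcol : ∀ j, ∃ a : ℝ, (fun i => M.adjugate i j) = a • r := by
    intro j
    refine hker _ ?_
    have h := M.mul_adjugate
    rw [hdet, zero_smul] at h
    funext i
    exact congrFun (congrFun h i) j
  choose q hq using hcol
  have hadj : M.adjugate = Matrix.vecMulVec r q := by
    ext i j
    rw [Matrix.vecMulVec_apply, mul_comm]
    exact congrFun (hq j) i
  have hqM : q ᵥ* M = 0 := by
    have h := M.adjugate_mul
    rw [hdet, zero_smul, hadj, Matrix.vecMulVec_mul] at h
    obtain ⟨i, hi⟩ := Function.ne_iff.1 hr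
    funext j
    have := congrFun (congrFun h i) j
    rw [Matrix.vecMulVec_apply] at this
    exact (mul_eq_zero.1 this).resolve_left hi
  obtain ⟨c, hc⟩ := eq_smul_of_vecMul_eq_zero hr hℓ hker hℓM hqM
  refine ⟨c, ?_, ?_⟩
  · rintro rfl
    refine adjugate_ne_zero_of_ker hr hMr hker ?_
    rw [hadj, hc]
    simp
  · rw [hadj, hc, Matrix.vecMulVec_smul]

end

lemma lintegral_comp_add_mul {G : ℝ → ℝ≥0∞} (hG : Measurable G) (z : ℝ) {δ : ℝ} (hδ : 0 < δ) :
    ∫⁻ s, G (z + δ * s) = (ENNReal.ofReal δ)⁻¹ * ∫⁻ t, G t := by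
  have h1 : ∫⁻ s, G (z + δ * s) = ∫⁻ u, G (z + u) ∂(Measure.map (δ * ·) volume) := by
    rw [lintegral_map (by fun_prop) (by fun_prop)]
  rw [h1, Real.map_volume_mul_left hδ.ne', lintegral_smul_measure, lintegral_add_left_eq_self,
    abs_of_pos (inv_pos.2 hδ), ENNReal.ofReal_inv_of_pos hδ, smul_eq_mul]

lemma eventually_abs_lt_of_hasDerivAt {f : ℝ → ℝ} {f' z s : ℝ} (hf : HasDerivAt f f' z)
    (hz : f z = 0) (hs : |f' * s| < 1 / 2) {δ : ℕ → ℝ} (hδ : ∀ k, 0 < δ k)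
    (hδ0 : Filter.Tendsto δ Filter.atTop (nhds 0)) :
    ∀ᶠ k in Filter.atTop, |f (z + δ k * s)| < δ k / 2 := by
  have h1 : HasDerivAt (fun u : ℝ => f (z + u * s)) (f' * s) 0 := by
    have hl : HasDerivAt (fun u : ℝ => z + u * s) s 0 := by
      simpa using ((hasDerivAt_id (0 : ℝ)).mul_const s).const_add z
    have hf0 : HasDerivAt f f' (z + 0 * s) := by simpa using hf
    exact hf0.comp (0 : ℝ) hl
  have h2 := (hasDerivAt_iff_tendsto_slope.1 h1).comp
    (tendsto_nhdsWithin_iff.2 ⟨hδ0, Filter.Eventually.of_forall fun k => (hδ k).ne'⟩)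
  have h3 := h2.abs.eventually_lt_const hs
  filter_upwards [h3] with k hk
  simp only [Function.comp_apply, slope_def_field, zero_mul, add_zero, hz, sub_zero, abs_div,
    abs_of_pos (hδ k)] at hk
  rw [div_lt_iff₀ (hδ k)] at hk
  linarith

/-- Lower bound in the Kac counting formula. -/
lemma sum_le_liminf_kac {f w f' : ℝ → ℝ} (hf : Continuous f) (hw : Continuous w) {a b : ℝ}
    (Z : Finset ℝ) (hZ : ∀ z ∈ Z, z ∈ Set.Ioo a b) (hf' : ∀ z ∈ Z, HasDerivAt f (f' z) z)
    (hz : ∀ z ∈ Z, f z = 0) (hne : ∀ z ∈ Z, f' z ≠ 0) {ε : ℕ → ℝ} (hε : ∀ k, 0 < ε k)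
    (hε0 : Filter.Tendsto ε Filter.atTop (nhds 0)) :
    ∑ z ∈ Z, ENNReal.ofReal (w z / |f' z|) ≤
      Filter.liminf (fun k => (ENNReal.ofReal (2 * ε k))⁻¹ * ∫⁻ θ in Set.Ioo a b,
        {θ | |f θ| < ε k}.indicator (fun θ => ENNReal.ofReal (w θ)) θ) Filter.atTop := by
  obtain ⟨U, hU, hdisj⟩ := Z.finite_toSet.t2_separation
  have hV : ∀ z, MeasurableSet (U z ∩ Set.Ioo a b) := fun z =>
    (hU z).2.measurableSet.inter measurableSet_Ioo
  have hδ : ∀ k, 0 < 2 * ε k := fun k => by have := hε k; linarith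
  have hδ0 : Filter.Tendsto (fun k => 2 * ε k) Filter.atTop (nhds 0) := by
    simpa using hε0.const_mul 2
  set F : ℕ → ℝ → ℝ≥0∞ := fun k => {θ | |f θ| < ε k}.indicator (fun θ => ENNReal.ofReal (w θ))
  have hF : ∀ k, Measurable (F k) := fun k =>
    Measurable.indicator (by fun_prop) (measurableSet_lt (by fun_prop) (by fun_prop))
  set g : ℕ → ℝ → ℝ≥0∞ := fun k s =>
    ∑ z ∈ Z, (U z ∩ Set.Ioo a b).indicator (F k) (z + 2 * ε k * s)
  have hgz : ∀ k z, Measurable fun s : ℝ =>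
      (U z ∩ Set.Ioo a b).indicator (F k) (z + 2 * ε k * s) := fun k z =>
    ((hF k).indicator (hV z)).comp (by fun_prop)
  have hg : ∀ k, Measurable (g k) := fun k => Finset.measurable_fun_sum _ fun z _ => hgz k z
  have hle : ∀ k, ∫⁻ s, g k s ≤ (ENNReal.ofReal (2 * ε k))⁻¹ * ∫⁻ θ in Set.Ioo a b, F k θ := by
    intro k
    simp only [g]
    rw [lintegral_finsetSum _ fun z _ => hgz k z]
    simp_rw [lintegral_comp_add_mul ((hF k).indicator (hV _)) _ (hδ k)]
    rw [← Finset.mul_sum]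
    gcongr
    simp_rw [lintegral_indicator (hV _)]
    rw [← lintegral_biUnion_finset (fun x hx y hy hxy =>
      (hdisj hx hy hxy).mono Set.inter_subset_left Set.inter_subset_left) fun z _ => hV z]
    exact lintegral_mono_set (Set.iUnion₂_subset fun z _ => Set.inter_subset_right)
  have hsum_eq : ∑ z ∈ Z, ENNReal.ofReal (w z / |f' z|) =
      ∫⁻ s, ∑ z ∈ Z, (Set.Ioo (-(1 / (2 * |f' z|))) (1 / (2 * |f' z|))).indicator
        (fun _ => ENNReal.ofReal (w z)) s := by
    rw [lintegral_finsetSum _ fun z _ => measurable_const.indicator measurableSet_Ioo]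
    refine Finset.sum_congr rfl fun z hzZ => ?_
    have hpos : 0 < |f' z| := abs_pos.2 (hne z hzZ)
    rw [lintegral_indicator_const measurableSet_Ioo, Real.volume_Ioo,
      ← ENNReal.ofReal_mul' (by rw [sub_neg_eq_add]; positivity)]
    congr 1
    field_simp
    ring
  rw [hsum_eq]
  calc _ ≤ ∫⁻ s, Filter.liminf (fun k => g k s) Filter.atTop := by
        refine lintegral_mono fun s => ?_
        set J : ℝ → Set ℝ := fun z => Set.Ioo (-(1 / (2 * |f' z|))) (1 / (2 * |f' z|))
        have hlim : Filter.Tendsto (fun k => ∑ z ∈ Z, (J z).indicator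
            (fun s => ENNReal.ofReal (w (z + 2 * ε k * s))) s) Filter.atTop
            (nhds (∑ z ∈ Z, (J z).indicator (fun _ => ENNReal.ofReal (w z)) s)) := by
          refine tendsto_finsetSum _ fun z _ => ?_
          by_cases hs : s ∈ J z
          · simp only [Set.indicator_of_mem hs]
            refine ENNReal.tendsto_ofReal ?_
            have h1 : Filter.Tendsto (fun k => z + 2 * ε k * s) Filter.atTop (nhds z) := by
              simpa using (hδ0.mul_const s).const_add z
            exact (hw.tendsto z).comp h1
          · simp only [Set.indicator_of_notMem hs]
            exact tendsto_const_nhds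
        simp only
        rw [← hlim.liminf_eq]
        refine Filter.liminf_le_liminf ?_
        have hev : ∀ z ∈ Z, ∀ᶠ k in Filter.atTop,
            (J z).indicator (fun s => ENNReal.ofReal (w (z + 2 * ε k * s))) s ≤
              (U z ∩ Set.Ioo a b).indicator (F k) (z + 2 * ε k * s) := by
          intro z hzZ
          by_cases hs : s ∈ J z
          · have hpos : 0 < |f' z| := abs_pos.2 (hne z hzZ)
            have hs' : |f' z * s| < 1 / 2 := by
              have : |s| < 1 / (2 * |f' z|) := abs_lt.2 hs
              rw [abs_mul]
              calc |f' z| * |s| < |f' z| * (1 / (2 * |f' z|)) := by gcongr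
                _ = 1 / 2 := by field_simp
            have h1 : Filter.Tendsto (fun k => z + 2 * ε k * s) Filter.atTop (nhds z) := by
              simpa using (hδ0.mul_const s).const_add z
            have h2 := h1.eventually (((hU z).2.inter isOpen_Ioo).mem_nhds ⟨(hU z).1, hZ z hzZ⟩)
            filter_upwards [h2, eventually_abs_lt_of_hasDerivAt (hf' z hzZ) (hz z hzZ) hs' hδ hδ0]
              with k hk1 hk2
            have hk3 : z + 2 * ε k * s ∈ {θ | |f θ| < ε k} := by
              rw [Set.mem_ofPred_eq]
              linarith
            rw [Set.indicator_of_mem hs,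
              Set.indicator_of_mem (show _ ∈ U z ∩ Set.Ioo a b from hk1)]
            simp only [F]
            rw [Set.indicator_of_mem hk3]
          · exact Filter.Eventually.of_forall fun k => by
              rw [Set.indicator_of_notMem hs]
              exact zero_le
        filter_upwards [(Filter.eventually_all_finset Z).2 hev] with k hk
        exact Finset.sum_le_sum hk
    _ ≤ Filter.liminf (fun k => ∫⁻ s, g k s) Filter.atTop := lintegral_liminf_le hg
    _ ≤ _ := Filter.liminf_le_liminf (Filter.Eventually.of_forall hle)

/-- The derivative of `θ ↦ P(A, cos θ, sin θ)`. -/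
noncomputable def dPang (n d : ℕ) (A : MatTuple n d) (θ : ℝ) : Matrix (Fin n) (Fin n) ℝ :=
  Real.cos θ • Pβ n d A (Real.cos θ) (Real.sin θ) - Real.sin θ • Pα n d A (Real.cos θ) (Real.sin θ)

/-- The coefficient `cosⁱ θ sin^{d-i} θ`. -/
noncomputable def angCoeff (d : ℕ) (i : Fin (d + 1)) (θ : ℝ) : ℝ :=
  Real.cos θ ^ (i : ℕ) * Real.sin θ ^ (d - (i : ℕ))

/-- The derivative of `angCoeff`. -/
noncomputable def angCoeff' (d : ℕ) (i : Fin (d + 1)) (θ : ℝ) : ℝ :=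
  Real.cos θ * (((d : ℝ) - ((i : ℕ) : ℝ)) * Real.cos θ ^ (i : ℕ) * Real.sin θ ^ (d - (i : ℕ) - 1)) -
    Real.sin θ * (((i : ℕ) : ℝ) * Real.cos θ ^ ((i : ℕ) - 1) * Real.sin θ ^ (d - (i : ℕ)))

lemma hasDerivAt_angCoeff (d : ℕ) (i : Fin (d + 1)) (θ : ℝ) :
    HasDerivAt (angCoeff d i) (angCoeff' d i θ) θ := by
  have h := ((Real.hasDerivAt_cos θ).fun_pow (i : ℕ)).fun_mul
    ((Real.hasDerivAt_sin θ).fun_pow (d - (i : ℕ)))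
  refine h.congr_deriv ?_
  rw [Nat.cast_sub (Nat.lt_succ_iff.1 i.2), angCoeff']
  ring

lemma Pang_apply (n d : ℕ) (A : MatTuple n d) (θ : ℝ) (a k : Fin n) :
    Pang n d A θ a k = ∑ i, angCoeff d i θ * A i a k := Pmat_apply n d A _ _ a k

lemma dPang_apply (n d : ℕ) (A : MatTuple n d) (θ : ℝ) (a k : Fin n) :
    dPang n d A θ a k = ∑ i, angCoeff' d i θ * A i a k := by
  simp only [dPang, Pα, Pβ, Matrix.sub_apply, Matrix.smul_apply, Matrix.sum_apply, smul_eq_mul,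
    Matrix.of_apply, Finset.mul_sum, ← Finset.sum_sub_distrib]
  refine Finset.sum_congr rfl fun i _ => ?_
  rw [angCoeff']
  ring

lemma hasDerivAt_Pang (n d : ℕ) (A : MatTuple n d) (θ : ℝ) (a k : Fin n) :
    HasDerivAt (fun s => Pang n d A s a k) (dPang n d A θ a k) θ := by
  simp only [Pang_apply, dPang_apply]
  exact HasDerivAt.fun_sum fun i _ => (hasDerivAt_angCoeff d i θ).mul_const _

/-- The derivative of `θ ↦ det P(A, cos θ, sin θ)`. -/
noncomputable def detDeriv (n d : ℕ) (A : MatTuple n d) (θ : ℝ) : ℝ :=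
  ((Pang n d A θ).adjugate * dPang n d A θ).trace

lemma hasDerivAt_det_Pang (n d : ℕ) (A : MatTuple n d) (θ : ℝ) :
    HasDerivAt (fun s => (Pang n d A s).det) (detDeriv n d A θ) θ :=
  hasDerivAt_det (hasDerivAt_Pang n d A θ)

lemma vvec_eq_neg_dPang_mulVec (n d : ℕ) (A : MatTuple n d) (θ : ℝ) (r : Fin n → ℝ) :
    vvec n d A (Real.cos θ) (Real.sin θ) r = -(dPang n d A θ *ᵥ r) := by
  simp only [vvec, dPang, Matrix.sub_mulVec, Matrix.smul_mulVec]
  abel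

/-- The kernels of `P(A, cos θ, sin θ)` are one-dimensional and transversal to the derivative, and
`[1 : 0]` is not an eigenvalue. -/
def Regular (n d : ℕ) (A : MatTuple n d) : Prop :=
  (Pang n d A 0).det ≠ 0 ∧ ∀ θ ∈ Set.Ioo 0 π, ∀ r : Fin n → ℝ, r ≠ 0 → Pang n d A θ *ᵥ r = 0 →
    ∀ (c : ℝ) (r' : Fin n → ℝ), c • (dPang n d A θ *ᵥ r) + Pang n d A θ *ᵥ r' = 0 →
    c = 0 ∧ ∃ x : ℝ, r' = x • r

lemma ae_regular (n d : ℕ) : ∀ᵐ A ∂gaussTuple n d, Regular n d A := by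
  refine (gaussTuple_absolutelyContinuous n d).ae_le ?_
  filter_upwards [ae_transversal (n := n) (angCoeff d) (angCoeff' d) 0 (hasDerivAt_angCoeff d),
    ae_transversal (n := n) (fun i _ => angCoeff d i 0) (fun (i : Fin (d + 1)) _ => 0) (Fin.last d)
      (fun i t => hasDerivAt_const t _)] with A h1 h2
  have hP : ∀ (θ : ℝ) (r : Fin n → ℝ) (a : Fin n), (Pang n d A θ *ᵥ r) a =
      ∑ p : Fin (d + 1) × Fin n, angCoeff d p.1 θ * A p.1 a p.2 * r p.2 := by
    intro θ r a
    simp only [Matrix.mulVec, dotProduct, Pang_apply, Finset.sum_mul]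
    rw [Fintype.sum_prod_type, Finset.sum_comm]
  have hdP : ∀ (θ : ℝ) (r : Fin n → ℝ) (a : Fin n), (dPang n d A θ *ᵥ r) a =
      ∑ p : Fin (d + 1) × Fin n, angCoeff' d p.1 θ * A p.1 a p.2 * r p.2 := by
    intro θ r a
    simp only [Matrix.mulVec, dotProduct, dPang_apply, Finset.sum_mul]
    rw [Fintype.sum_prod_type, Finset.sum_comm]
  constructor
  · intro hdet
    obtain ⟨r, hr, hr0⟩ := Matrix.exists_mulVec_eq_zero_iff.2 hdet
    have := (h2 0 (by simp [angCoeff]) r hr (fun a => by rw [← hP, hr0]; rfl) 1 0 (by simp)).1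
    exact one_ne_zero this
  · intro θ hθ r hr hr0 c r' hc
    refine h1 θ ?_ r hr (fun a => by rw [← hP, hr0]; rfl) c r' fun a => ?_
    · have := Real.sin_pos_of_mem_Ioo hθ
      simp [angCoeff, this.ne']
    · have := congrFun hc a
      rw [Pi.add_apply, Pi.smul_apply, hP, hdP, smul_eq_mul, Finset.mul_sum,
        ← Finset.sum_add_distrib] at this
      exact (Finset.sum_congr rfl fun p _ => by ring).trans this

lemma ker_toLin'_eq_span_iff {n : ℕ} {M : Matrix (Fin n) (Fin n) ℝ} {r : Fin n → ℝ} :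
    LinearMap.ker (Matrix.toLin' M) = Submodule.span ℝ {r} ↔
      M *ᵥ r = 0 ∧ ∀ x, M *ᵥ x = 0 → ∃ a : ℝ, x = a • r := by
  constructor
  · intro h
    have hmem : ∀ x, M *ᵥ x = 0 ↔ x ∈ Submodule.span ℝ {r} := by
      intro x
      rw [← h, LinearMap.mem_ker, Matrix.toLin'_apply]
    refine ⟨(hmem r).2 (Submodule.mem_span_singleton_self r), fun x hx => ?_⟩
    obtain ⟨a, ha⟩ := Submodule.mem_span_singleton.1 ((hmem x).1 hx)
    exact ⟨a, ha.symm⟩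
  · rintro ⟨h1, h2⟩
    ext x
    rw [LinearMap.mem_ker, Matrix.toLin'_apply, Submodule.mem_span_singleton]
    constructor
    · intro hx
      obtain ⟨a, ha⟩ := h2 x hx
      exact ⟨a, ha.symm⟩
    · rintro ⟨a, rfl⟩
      rw [Matrix.mulVec_smul, h1, smul_zero]

lemma frob_smul_vecMulVec {n : ℕ} (c : ℝ) (r ℓ : Fin n → ℝ) :
    frob (c • Matrix.vecMulVec r ℓ) = |c| * (vnorm n r * vnorm n ℓ) := by
  rw [frob, vnorm, vnorm, ← Real.sqrt_mul (Finset.sum_nonneg fun i _ => sq_nonneg _),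
    ← Real.sqrt_sq_eq_abs, ← Real.sqrt_mul (sq_nonneg c), Finset.sum_mul_sum, Finset.mul_sum]
  congr 1
  refine Finset.sum_congr rfl fun i _ => ?_
  rw [Finset.mul_sum]
  refine Finset.sum_congr rfl fun j _ => ?_
  rw [Matrix.smul_apply, Matrix.vecMulVec_apply, smul_eq_mul]
  ring

lemma GoodPair.muVal_eq {n d : ℕ} {A : MatTuple n d} {θ : ℝ} {r ℓ : Fin n → ℝ}
    (h : GoodPair n d A (Real.cos θ) (Real.sin θ) r ℓ) :
    detDeriv n d A θ ≠ 0 ∧ muVal n d A (Real.cos θ) (Real.sin θ) r ℓ =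
      tnorm n d A * (gradNorm n d A θ / |detDeriv n d A θ|) := by
  obtain ⟨hr, hℓ, hkr, hkℓ, hv⟩ := h
  obtain ⟨hMr, hker⟩ := ker_toLin'_eq_span_iff.1 hkr
  have hMℓ := (ker_toLin'_eq_span_iff.1 hkℓ).1
  rw [Matrix.mulVec_transpose] at hMℓ
  obtain ⟨c, hc, hadj⟩ := exists_adjugate_eq_vecMulVec hr hℓ hMr hker hMℓ
  have hder : detDeriv n d A θ =
      -(c * ∑ j, ℓ j * vvec n d A (Real.cos θ) (Real.sin θ) r j) := by
    have : ∑ j, ℓ j * vvec n d A (Real.cos θ) (Real.sin θ) r j = -(ℓ ⬝ᵥ (dPang n d A θ *ᵥ r)) := by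
      rw [vvec_eq_neg_dPang_mulVec, ← dotProduct_neg]
      rfl
    rw [this, detDeriv, Pang, hadj, Matrix.smul_mul, Matrix.trace_smul, Matrix.vecMulVec_mul,
      Matrix.trace_vecMulVec, dotProduct_comm, ← Matrix.dotProduct_mulVec, smul_eq_mul]
    ring
  have hne : detDeriv n d A θ ≠ 0 := by
    rw [hder]
    exact neg_ne_zero.2 (mul_ne_zero hc hv)
  refine ⟨hne, ?_⟩
  have hfrob : gradNorm n d A θ = monNorm d θ * (|c| * (vnorm n r * vnorm n ℓ)) := by
    rw [gradNorm, Pang, hadj, frob_smul_vecMulVec]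
  rw [hfrob, hder, abs_neg, abs_mul, muVal, ← monNorm]
  have h1 : |c| ≠ 0 := abs_ne_zero.2 hc
  have h2 := abs_ne_zero.2 hv
  field_simp

lemma Regular.exists_goodPair {n d : ℕ} {A : MatTuple n d} (hA : Regular n d A) {θ : ℝ}
    (hθ : θ ∈ Set.Ioo 0 π) (hdet : (Pang n d A θ).det = 0) :
    ∃ p : (Fin n → ℝ) × (Fin n → ℝ), GoodPair n d A (Real.cos θ) (Real.sin θ) p.1 p.2 := by
  obtain ⟨r, hr, hMr⟩ := Matrix.exists_mulVec_eq_zero_iff.2 hdet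
  obtain ⟨ℓ, hℓ, hℓM⟩ := Matrix.exists_vecMul_eq_zero_iff.2 hdet
  have hreg := hA.2 θ hθ r hr hMr
  have hker : ∀ x, Pang n d A θ *ᵥ x = 0 → ∃ a : ℝ, x = a • r := fun x hx =>
    (hreg 0 x (by rw [zero_smul, zero_add, hx])).2
  refine ⟨(r, ℓ), hr, hℓ, ker_toLin'_eq_span_iff.2 ⟨hMr, hker⟩, ker_toLin'_eq_span_iff.2
    ⟨by rw [Matrix.mulVec_transpose]; exact hℓM, fun x hx => ?_⟩, fun hv => ?_⟩
  · rw [Matrix.mulVec_transpose] at hx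
    exact eq_smul_of_vecMul_eq_zero hr hℓ hker hℓM hx
  · have hv' : ℓ ⬝ᵥ vvec n d A (Real.cos θ) (Real.sin θ) r = 0 := hv
    obtain ⟨x, hx⟩ := exists_mulVec_eq_of_dotProduct_eq_zero hr hℓ hker hℓM hv'
    rw [vvec_eq_neg_dPang_mulVec] at hx
    exact one_ne_zero (hreg 1 x (by rw [hx, one_smul, add_neg_cancel])).1

lemma Regular.muLoc_eq {n d : ℕ} {A : MatTuple n d} (hA : Regular n d A) {θ : ℝ}
    (hθ : θ ∈ Set.Ioo 0 π) (hdet : (Pang n d A θ).det = 0) :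
    detDeriv n d A θ ≠ 0 ∧ muLoc n d A (Real.cos θ) (Real.sin θ) =
      ENNReal.ofReal (tnorm n d A) *
        ENNReal.ofReal (gradNorm n d A θ / |detDeriv n d A θ|) := by
  have h := hA.exists_goodPair hθ hdet
  obtain ⟨h1, h2⟩ := h.choose_spec.muVal_eq
  refine ⟨h1, ?_⟩
  rw [muLoc, dif_pos h, h2, ENNReal.ofReal_mul (tnorm_nonneg n d A)]

lemma Regular.det_Pang_pi_ne_zero {n d : ℕ} {A : MatTuple n d} (hA : Regular n d A) :
    (Pang n d A π).det ≠ 0 := by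
  have h : Pang n d A π = (-1 : ℝ) ^ d • Pang n d A 0 := by
    ext a k
    rw [Matrix.smul_apply, Pang_apply, Pang_apply, smul_eq_mul, Finset.mul_sum]
    refine Finset.sum_congr rfl fun i _ => ?_
    rcases (Nat.lt_succ_iff.1 i.2).eq_or_lt with hi | hi
    · simp [angCoeff, hi]
    · simp [angCoeff, (Nat.sub_pos_of_lt hi).ne']
  rw [h, Matrix.det_smul]
  exact mul_ne_zero (pow_ne_zero _ (pow_ne_zero _ (by norm_num))) hA.1

/-- The angles in `(0, π)` of the polynomial eigenvalues. -/
def eigAngles (n d : ℕ) (A : MatTuple n d) : Set ℝ := {θ ∈ Set.Ioo 0 π | (Pang n d A θ).det = 0}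

lemma Regular.finite_eigAngles {n d : ℕ} {A : MatTuple n d} (hA : Regular n d A) :
    (eigAngles n d A).Finite := by
  by_contra hinf
  obtain ⟨x, hx, hacc⟩ := Set.Infinite.exists_accPt_of_subset_isCompact hinf
    (isCompact_Icc (a := 0) (b := π)) fun θ hθ => Set.Ioo_subset_Icc_self hθ.1
  have hfreq := accPt_iff_frequently_nhdsNE.1 hacc
  have hx0 : (Pang n d A x).det = 0 := by
    by_contra hne
    refine hfreq ?_
    have := (hasDerivAt_det_Pang n d A x).continuousAt.eventually_ne hne
    filter_upwards [this.filter_mono nhdsWithin_le_nhds] with y hy hyZ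
    exact hy hyZ.2
  have hxI : x ∈ Set.Ioo 0 π := by
    refine ⟨hx.1.lt_of_ne ?_, hx.2.lt_of_ne ?_⟩
    · rintro rfl
      exact hA.1 hx0
    · rintro rfl
      exact hA.det_Pang_pi_ne_zero hx0
  refine hfreq ?_
  filter_upwards [(hasDerivAt_det_Pang n d A x).eventually_ne (c := 0) (hA.muLoc_eq hxI hx0).1]
    with y hy hyZ
  exact hy hyZ.2

lemma Regular.pevReps_eq_image {n d : ℕ} {A : MatTuple n d} (hA : Regular n d A) :
    pevReps n d A = (fun θ => (Real.cos θ, Real.sin θ)) '' eigAngles n d A := by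
  ext ⟨α, β⟩
  constructor
  · rintro ⟨⟨hαβ, h⟩, hdet⟩
    simp only at hαβ h
    rcases h with hβ | ⟨rfl, rfl⟩
    · have hα1 : -1 ≤ α := by nlinarith
      have hα2 : α ≤ 1 := by nlinarith
      have hcos := Real.cos_arccos hα1 hα2
      have hsin : Real.sin (Real.arccos α) = β := by
        rw [Real.sin_arccos, show 1 - α ^ 2 = β ^ 2 by linarith, Real.sqrt_sq hβ.le]
      refine ⟨Real.arccos α, ⟨⟨?_, ?_⟩, ?_⟩, by simp only [hcos, hsin]⟩
      · refine (Real.arccos_nonneg α).lt_of_ne fun h0 => ?_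
        rw [← h0, Real.sin_zero] at hsin
        exact hβ.ne hsin
      · refine (Real.arccos_le_pi α).lt_of_ne fun h0 => ?_
        rw [h0, Real.sin_pi] at hsin
        exact hβ.ne hsin
      · rw [Pang, hcos, hsin]
        exact hdet
    · refine absurd ?_ hA.1
      rw [Pang, Real.cos_zero, Real.sin_zero]
      exact hdet
  · rintro ⟨θ, ⟨hθ, hdet⟩, h⟩
    obtain ⟨rfl, rfl⟩ := Prod.mk.inj h
    exact ⟨⟨by simp, Or.inl (Real.sin_pos_of_mem_Ioo hθ)⟩, hdet⟩

lemma Regular.muTotal_eq {n d : ℕ} {A : MatTuple n d} (hA : Regular n d A) :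
    muTotal n d A = ENNReal.ofReal (tnorm n d A) * ∑ θ ∈ hA.finite_eigAngles.toFinset,
      ENNReal.ofReal (gradNorm n d A θ / |detDeriv n d A θ|) := by
  have hfin : ¬ (pevReps n d A).Infinite := by
    rw [Set.not_infinite, hA.pevReps_eq_image]
    exact hA.finite_eigAngles.image _
  have hinj : Set.InjOn (fun θ => (Real.cos θ, Real.sin θ)) (eigAngles n d A) :=
    fun x hx y hy hxy => Real.injOn_cos (Set.Ioo_subset_Icc_self hx.1)
      (Set.Ioo_subset_Icc_self hy.1) (Prod.mk.inj hxy).1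
  rw [muTotal, if_neg hfin, hA.pevReps_eq_image,
    tsum_image (fun x : ℝ × ℝ => muLoc n d A x.1 x.2) hinj, Finset.mul_sum]
  have hset : eigAngles n d A = (hA.finite_eigAngles.toFinset : Set ℝ) := by simp
  refine (tsum_congr_set_coe (fun θ => muLoc n d A (Real.cos θ) (Real.sin θ)) hset).trans
    ((Finset.tsum_subtype' _ fun θ => muLoc n d A (Real.cos θ) (Real.sin θ)).trans ?_)
  refine Finset.sum_congr rfl fun θ hθ => ?_
  have := hA.finite_eigAngles.mem_toFinset.1 hθ
  exact (hA.muLoc_eq this.1 this.2).2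

lemma Regular.muTotal_le_liminf {n d : ℕ} {A : MatTuple n d} (hA : Regular n d A) {ε : ℕ → ℝ}
    (hε : ∀ k, 0 < ε k) (hε0 : Filter.Tendsto ε Filter.atTop (nhds 0)) :
    muTotal n d A ≤ ENNReal.ofReal (tnorm n d A) *
      Filter.liminf (fun k => kacSum n d A (ε k)) Filter.atTop := by
  rw [hA.muTotal_eq]
  gcongr
  have hmem := fun θ (hθ : θ ∈ hA.finite_eigAngles.toFinset) =>
    hA.finite_eigAngles.mem_toFinset.1 hθ
  have hA' : Continuous fun θ : ℝ => (A, θ) := by fun_prop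
  exact sum_le_liminf_kac (f := fun θ => (Pang n d A θ).det) (f' := detDeriv n d A)
    (w := gradNorm n d A)
    (continuous_iff_continuousAt.2 fun θ => (hasDerivAt_det_Pang n d A θ).continuousAt)
    (by simpa only [Function.comp_def] using (continuous_gradNorm n d).comp hA') _
    (fun θ hθ => (hmem θ hθ).1) (fun θ _ => hasDerivAt_det_Pang n d A θ)
    (fun θ hθ => (hmem θ hθ).2)
    (fun θ hθ => (hA.muLoc_eq (hmem θ hθ).1 (hmem θ hθ).2).1) hε hε0

/-- **Universal upper bound for the expected condition number of Gaussian PEVPs**: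
`E μ(A) ≤ √π · n · Γ((d+1)n²/2)/Γ(((d+1)n²−1)/2)`. -/
theorem expected_condition_number_gaussian_le (n d : ℕ) (hn : 1 ≤ n) (hd : 1 ≤ d) :
    ∫⁻ A, muTotal n d A ∂(gaussTuple n d) ≤
      ENNReal.ofReal
        (Real.sqrt π * (n : ℝ) *
          (Real.Gamma ((((d : ℝ) + 1) * (n : ℝ) ^ 2) / 2) /
            Real.Gamma ((((d : ℝ) + 1) * (n : ℝ) ^ 2 - 1) / 2))) := by
  refine lintegral_muTotal_le_of_kac n d hn hd ?_
  filter_upwards [ae_regular n d] with A hA ε hε hε0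
  exact hA.muTotal_le_liminf hε hε0

end PEVP
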